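/- arXiv:2008.04790 — 6 statements merged into one kernel-verified Lean document; each statement's English description precedes it below -/
import Mathlib

section
/- Let σ₁, σ₂ : {1,…,N} → {1,…,K} be node labellings and let N_min = min_k |σ₁^{-1}(k)|. If a permutation τ* of {1,…,K} satisfies Ham(σ₁, τ* ∘ σ₂) < N_min/2, then τ* is the unique minimiser of τ ↦ Ham(σ₁, τ ∘ σ₂) over permutations τ of {1,…,K}; that is, Ham(σ₁, τ ∘ σ₂) > Ham(σ₁, τ* ∘ σ₂) for every permutation τ ≠ τ*. -/
open Finset

/-- Hamming distance between two node labellings. -/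
def ham {N K : ℕ} (σ₁ σ₂ : Fin N → Fin K) : ℕ :=
  (Finset.univ.filter fun i => σ₁ i ≠ σ₂ i).card

/-- Number of nodes with label `k` under the labelling `σ`. -/
def blockCount {N K : ℕ} (σ : Fin N → Fin K) (k : Fin K) : ℕ :=
  (Finset.univ.filter fun i => σ i = k).card

/-- If no node receives label `k` under both `ρ₁` and `ρ₂`, every node of block `k` of `σ` is
misclassified by one of them. -/
theorem blockCount_le_ham_add_ham {N K : ℕ} {σ ρ₁ ρ₂ : Fin N → Fin K} {k : Fin K}
    (hk : ∀ i, ρ₁ i = k → ρ₂ i ≠ k) :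
    blockCount σ k ≤ ham σ ρ₁ + ham σ ρ₂ := by
  unfold blockCount ham
  refine (Finset.card_le_card fun i hi => ?_).trans (Finset.card_union_le _ _)
  simp only [Finset.mem_filter, Finset.mem_univ, true_and, Finset.mem_union] at hi ⊢
  by_contra! hne
  exact hk i (hne.1.symm.trans hi) (hne.2.symm.trans hi)

/-- If some block permutation `τ*` satisfies `Ham(σ₁, τ* ∘ σ₂) < N_min/2`, then `τ*` is the
unique minimiser of `τ ↦ Ham(σ₁, τ ∘ σ₂)`. -/
theorem unique_optimal_permutation
    (N K : ℕ) [NeZero K] (σ₁ σ₂ : Fin N → Fin K)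
    (τstar : Equiv.Perm (Fin K))
    (h : (ham σ₁ (fun i => τstar (σ₂ i)) : ℝ) <
      ((Finset.univ.inf' Finset.univ_nonempty fun k => blockCount σ₁ k : ℕ) : ℝ) / 2) :
    ∀ τ : Equiv.Perm (Fin K), τ ≠ τstar →
      ham σ₁ (fun i => τstar (σ₂ i)) < ham σ₁ (fun i => τ (σ₂ i)) := by
  intro τ hτ
  obtain ⟨b, hb⟩ : ∃ b, τ b ≠ τstar b := by
    by_contra! heq
    exact hτ (Equiv.ext heq)
  have hblock : blockCount σ₁ (τstar b) ≤
      ham σ₁ (fun i => τstar (σ₂ i)) + ham σ₁ (fun i => τ (σ₂ i)) := by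
    refine blockCount_le_ham_add_ham fun i hi => ?_
    rwa [τstar.injective hi]
  have hmin : (Finset.univ.inf' Finset.univ_nonempty fun k => blockCount σ₁ k) ≤
      blockCount σ₁ (τstar b) := Finset.inf'_le _ (Finset.mem_univ _)
  have htwo : 2 * ham σ₁ (fun i => τstar (σ₂ i)) <
      Finset.univ.inf' Finset.univ_nonempty fun k => blockCount σ₁ k := by
    rw [lt_div_iff₀ two_pos, mul_comm] at h
    exact_mod_cast h
  omega
end

section
/- Let σ, σ' : {1,…,N} → {1,…,K} be optimally aligned node labellings, i.e. Ham*(σ, σ') = Ham(σ, σ'). Let N_{kℓ} = |σ^{-1}(k) ∩ (σ')^{-1}(ℓ)|, N_k = ∑_ℓ N_{kℓ} and N'_ℓ = ∑_k N_{kℓ}. Then for all k ≠ ℓ in {1,…,K}: N_{kℓ} + N_{ℓk} ≤ N_{kk} + N_{ℓℓ}, and N_{kℓ} ≤ (1/3)(N_k + N'_ℓ). -/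
open Finset

/-- Absolute classification error: minimum Hamming distance over relabellings of `σ₂`. -/
def hamStar {N K : ℕ} (σ₁ σ₂ : Fin N → Fin K) : ℕ :=
  Finset.univ.inf' Finset.univ_nonempty fun ρ : Equiv.Perm (Fin K) =>
    ham σ₁ (fun i => ρ (σ₂ i))

/-- Confusion matrix entry `N_{kℓ} = |σ⁻¹(k) ∩ (σ')⁻¹(ℓ)|`. -/
def confusion {N K : ℕ} (σ σ' : Fin N → Fin K) (k l : Fin K) : ℕ :=
  (Finset.univ.filter fun i => σ i = k ∧ σ' i = l).card

/-- Swapping the labels `k` and `l` of the second labelling trades diagonal confusion entries for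
off-diagonal ones. -/
theorem ham_swap_add_confusion {N K : ℕ} (σ σ' : Fin N → Fin K) {k l : Fin K} (hkl : k ≠ l) :
    ham σ (fun i => Equiv.swap k l (σ' i)) + (confusion σ σ' k l + confusion σ σ' l k) =
      ham σ σ' + (confusion σ σ' k k + confusion σ σ' l l) := by
  simp only [ham, confusion, Finset.card_filter, ← Finset.sum_add_distrib]
  refine Finset.sum_congr rfl fun i _ => ?_
  simp only [Equiv.swap_apply_def]
  grind

theorem hamStar_le_ham_perm {N K : ℕ} (σ₁ σ₂ : Fin N → Fin K) (ρ : Equiv.Perm (Fin K)) :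
    hamStar σ₁ σ₂ ≤ ham σ₁ (fun i => ρ (σ₂ i)) :=
  Finset.inf'_le _ (Finset.mem_univ ρ)

/-- For optimally aligned labellings the confusion matrix satisfies
`N_{kℓ} + N_{ℓk} ≤ N_{kk} + N_{ℓℓ}` and `N_{kℓ} ≤ (N_k + N'_ℓ)/3` for `k ≠ ℓ`. -/
theorem confusion_matrix_of_optimally_aligned
    (N K : ℕ) (σ σ' : Fin N → Fin K)
    (haligned : hamStar σ σ' = ham σ σ')
    (k l : Fin K) (hkl : k ≠ l) :
    confusion σ σ' k l + confusion σ σ' l k ≤ confusion σ σ' k k + confusion σ σ' l l ∧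
    (confusion σ σ' k l : ℝ) ≤
      ((∑ j, (confusion σ σ' k j : ℝ)) + (∑ j, (confusion σ σ' j l : ℝ))) / 3 := by
  have hdiag : confusion σ σ' k l + confusion σ σ' l k ≤
      confusion σ σ' k k + confusion σ σ' l l := by
    have hswap := ham_swap_add_confusion σ σ' hkl
    have hle := hamStar_le_ham_perm σ σ' (Equiv.swap k l)
    omega
  refine ⟨hdiag, ?_⟩
  have hrow : confusion σ σ' k k + confusion σ σ' k l ≤ ∑ j, confusion σ σ' k j := by
    rw [← Finset.sum_pair hkl]
    exact Finset.sum_le_sum_of_subset (Finset.subset_univ _)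
  have hcol : confusion σ σ' k l + confusion σ σ' l l ≤ ∑ j, confusion σ σ' j l := by
    rw [← Finset.sum_pair (f := fun j => confusion σ σ' j l) hkl]
    exact Finset.sum_le_sum_of_subset (Finset.subset_univ _)
  rw [le_div_iff₀ (by norm_num)]
  norm_cast
  omega
end

section
/- For any node labellings σ, σ' : {1,…,N} → {1,…,K}, |E(σ) \ E(σ')| ≥ (1/2)(N_max^σ − N_max^{σ'}) · N_max^σ, where N_max^σ = max_k |σ^{-1}(k)| and N_max^{σ'} = max_k |(σ')^{-1}(k)|. -/
open Finset

/-- The set `E(σ)` of (ordered representatives `i < j` of) unordered pairs of distinct nodes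
getting the same label under `σ`. -/
def pairSet {N K : ℕ} (σ : Fin N → Fin K) : Finset (Fin N × Fin N) :=
  Finset.univ.filter fun p => p.1 < p.2 ∧ σ p.1 = σ p.2

/-- If every block of `σ'` has at most `m` elements, then at least `s.card * (s.card - m)` ordered
pairs of elements of `s` are separated by `σ'` (stated without subtraction). -/
theorem card_mul_card_le_card_separated_add {N K : ℕ} (σ' : Fin N → Fin K) (s : Finset (Fin N))
    (m : ℕ) (hm : ∀ k, blockCount σ' k ≤ m) :
    s.card * s.card ≤ ((s ×ˢ s).filter fun p => σ' p.1 ≠ σ' p.2).card + s.card * m := by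
  have hsame : ((s ×ˢ s).filter fun p => σ' p.1 = σ' p.2).card ≤ s.card * m := by
    rw [Finset.card_filter, Finset.sum_product, ← smul_eq_mul]
    refine Finset.sum_le_card_nsmul _ _ _ fun i _ => ?_
    rw [← Finset.card_filter]
    refine le_trans (Finset.card_le_card fun j hj => ?_) (hm (σ' i))
    simp only [Finset.mem_filter, Finset.mem_univ, true_and] at hj ⊢
    exact hj.2.symm
  have hsplit := Finset.card_filter_add_card_filter_not (s := s ×ˢ s) (fun p => σ' p.1 = σ' p.2)
  rw [Finset.card_product] at hsplit
  simp only [ne_eq]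
  omega

/-- The ordered pairs within one block of `σ` that `σ'` separates number at most twice the
unordered pairs in `E(σ) \ E(σ')`. -/
theorem card_separated_le_two_mul {N K : ℕ} (σ σ' : Fin N → Fin K) (k : Fin K) :
    (((Finset.univ.filter fun i => σ i = k) ×ˢ (Finset.univ.filter fun i => σ i = k)).filter
      fun p => σ' p.1 ≠ σ' p.2).card ≤ 2 * (pairSet σ \ pairSet σ').card := by
  have hsub : (((Finset.univ.filter fun i => σ i = k) ×ˢ
      (Finset.univ.filter fun i => σ i = k)).filter fun p => σ' p.1 ≠ σ' p.2) ⊆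
      (pairSet σ \ pairSet σ') ∪ (pairSet σ \ pairSet σ').image Prod.swap := by
    rintro ⟨i, j⟩ hp
    simp only [Finset.mem_filter, Finset.mem_product, Finset.mem_univ, true_and] at hp
    obtain ⟨⟨hi, hj⟩, hne⟩ := hp
    rw [Finset.mem_union, Finset.mem_image]
    rcases lt_trichotomy i j with h | h | h
    · left
      simp [pairSet, h, hi, hj, hne]
    · exact absurd (congrArg σ' h) hne
    · right
      exact ⟨(j, i), by simp [pairSet, h, hi, hj, Ne.symm hne], rfl⟩
  have h₁ := Finset.card_le_card hsub
  have h₂ := Finset.card_union_le (pairSet σ \ pairSet σ')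
    ((pairSet σ \ pairSet σ').image Prod.swap)
  have h₃ := Finset.card_image_le (s := pairSet σ \ pairSet σ') (f := Prod.swap)
  omega

/-- `|E(σ) \ E(σ')| ≥ (1/2)(N_max^σ − N_max^{σ'}) N_max^σ`. -/
theorem pair_diff_lower_bound_general
    (N K : ℕ) [NeZero K] (σ σ' : Fin N → Fin K) :
    (((pairSet σ) \ (pairSet σ')).card : ℝ) ≥
      (1 / 2) *
        (((Finset.univ.sup' Finset.univ_nonempty fun k => blockCount σ k : ℕ) : ℝ) -
          ((Finset.univ.sup' Finset.univ_nonempty fun k => blockCount σ' k : ℕ) : ℝ)) *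
        ((Finset.univ.sup' Finset.univ_nonempty fun k => blockCount σ k : ℕ) : ℝ) := by
  obtain ⟨k, -, hk⟩ := Finset.exists_mem_eq_sup' Finset.univ_nonempty fun k => blockCount σ k
  have hm : ∀ l, blockCount σ' l ≤
      Finset.univ.sup' Finset.univ_nonempty fun k => blockCount σ' k := fun l =>
    Finset.le_sup' (fun k => blockCount σ' k) (Finset.mem_univ l)
  rw [hk]
  generalize (Finset.univ.sup' Finset.univ_nonempty fun k => blockCount σ' k) = m at hm ⊢
  have h := (card_mul_card_le_card_separated_add σ'
    (Finset.univ.filter fun i => σ i = k) m hm).trans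
    (Nat.add_le_add_right (card_separated_le_two_mul σ σ' k) _)
  change blockCount σ k * blockCount σ k ≤ _ + blockCount σ k * m at h
  have h' : (blockCount σ k : ℝ) * blockCount σ k ≤
      2 * ((pairSet σ \ pairSet σ').card : ℝ) + blockCount σ k * m := by
    exact_mod_cast h
  linarith
end

section
/- For any node labellings σ, σ' : {1,…,N} → {1,…,K}, |E(σ) \ E(σ')| ≥ max{ N_min^σ − Ham*(σ,σ'), (1/3) N_min^σ − (1/6) N_max^{σ'} } · Ham*(σ, σ'), where N_min^σ = min_k |σ^{-1}(k)| and N_max^{σ'} = max_k |(σ')^{-1}(k)|. -/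
open Finset

/-- Number of nodes with label `a` under `σ` and label `b` under `σ'`. -/
def cellCount {N K : ℕ} (σ σ' : Fin N → Fin K) (a b : Fin K) : ℕ :=
  (Finset.univ.filter fun i => σ i = a ∧ σ' i = b).card

/-- Number of nodes with label `a` under `σ` and a label other than `b` under `σ'`. -/
def offCount {N K : ℕ} (σ σ' : Fin N → Fin K) (a b : Fin K) : ℕ :=
  (Finset.univ.filter fun i => σ i = a ∧ σ' i ≠ b).card

/-- Number of ordered pairs in block `a` of `σ` that are separated by `σ'`. -/
def rowSplit {N K : ℕ} (σ σ' : Fin N → Fin K) (a : Fin K) : ℕ :=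
  ∑ i ∈ Finset.univ.filter (fun i => σ i = a), offCount σ σ' a (σ' i)

section

variable {N K : ℕ} (σ σ' : Fin N → Fin K)

lemma cellCount_add_offCount (a b : Fin K) :
    cellCount σ σ' a b + offCount σ σ' a b = blockCount σ a := by
  simp only [cellCount, offCount, blockCount, ← filter_filter]
  exact card_filter_add_card_filter_not _

lemma cellCount_le_offCount (a : Fin K) {b c : Fin K} (h : b ≠ c) :
    cellCount σ σ' a b ≤ offCount σ σ' a c := by
  refine card_le_card fun i hi => ?_
  simp only [mem_filter, mem_univ, true_and] at hi ⊢
  exact ⟨hi.1, hi.2 ▸ h⟩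

lemma cellCount_add_cellCount_le {a c : Fin K} (h : a ≠ c) (b : Fin K) :
    cellCount σ σ' a b + cellCount σ σ' c b ≤ blockCount σ' b := by
  rw [cellCount, cellCount, blockCount, ← card_union_of_disjoint]
  · refine card_le_card fun i hi => ?_
    simp only [mem_union, mem_filter, mem_univ, true_and] at hi ⊢
    tauto
  · rw [disjoint_left]
    intro i hi hj
    simp only [mem_filter, mem_univ, true_and] at hi hj
    exact h (hi.1.symm.trans hj.1)

lemma two_mul_cellCount_mul_offCount_le_rowSplit (a b : Fin K) :
    2 * (cellCount σ σ' a b * offCount σ σ' a b) ≤ rowSplit σ σ' a := by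
  rw [rowSplit, ← sum_filter_add_sum_filter_not _ (fun i => σ' i = b), filter_filter,
    filter_filter, two_mul]
  refine add_le_add ?_ ?_
  · rw [cellCount, ← smul_eq_mul]
    refine card_nsmul_le_sum _ _ _ fun i hi => ?_
    simp only [mem_filter, mem_univ, true_and] at hi
    rw [hi.2]
  · rw [mul_comm, offCount, ← smul_eq_mul]
    refine card_nsmul_le_sum _ _ _ fun i hi => ?_
    simp only [mem_filter, mem_univ, true_and] at hi
    exact cellCount_le_offCount σ σ' a (Ne.symm hi.2)

lemma blockCount_mul_offCount_le_rowSplit {a b : Fin K}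
    (h : ∀ c, offCount σ σ' a b ≤ offCount σ σ' a c) :
    blockCount σ a * offCount σ σ' a b ≤ rowSplit σ σ' a := by
  rw [rowSplit, blockCount, ← smul_eq_mul]
  exact card_nsmul_le_sum _ _ _ fun i _ => h _

lemma two_mul_card_pairSet_sdiff :
    2 * ((pairSet σ) \ (pairSet σ')).card = ∑ a, rowSplit σ σ' a := by
  have hsum : ∑ a, rowSplit σ σ' a =
      (univ.filter fun p : Fin N × Fin N => σ p.2 = σ p.1 ∧ σ' p.2 ≠ σ' p.1).card := by
    rw [card_filter, ← univ_product_univ, sum_product,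
      ← sum_fiberwise (s := univ) (g := σ)]
    refine sum_congr rfl fun a _ => sum_congr rfl fun i hi => ?_
    simp only [offCount, card_filter, (mem_filter.1 hi).2]
  have hlt : (univ.filter fun p : Fin N × Fin N => σ p.2 = σ p.1 ∧ σ' p.2 ≠ σ' p.1).filter
      (fun p => p.1 < p.2) = pairSet σ \ pairSet σ' := by
    ext p
    simp only [pairSet, mem_filter, mem_univ, true_and, mem_sdiff]
    grind
  have hgt : (univ.filter fun p : Fin N × Fin N => σ p.2 = σ p.1 ∧ σ' p.2 ≠ σ' p.1).filter
      (fun p => ¬ p.1 < p.2) =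
      (pairSet σ \ pairSet σ').map (Equiv.prodComm (Fin N) (Fin N)).toEmbedding := by
    ext ⟨i, j⟩
    simp only [pairSet, mem_filter, mem_univ, true_and, mem_sdiff, mem_map_equiv,
      Equiv.prodComm_symm, Equiv.prodComm_apply, Prod.swap_prod_mk]
    rcases lt_trichotomy i j with h | h | h <;> grind
  have hsplit := card_filter_add_card_filter_not
    (s := univ.filter fun p : Fin N × Fin N => σ p.2 = σ p.1 ∧ σ' p.2 ≠ σ' p.1)
    (fun p : Fin N × Fin N => p.1 < p.2)
  rw [hlt, hgt, card_map] at hsplit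
  rw [hsum, ← hsplit, two_mul]

lemma ham_comp_perm (ρ : Equiv.Perm (Fin K)) :
    ham σ (fun i => ρ (σ' i)) = ∑ a, offCount σ σ' a (ρ.symm a) := by
  rw [ham, card_eq_sum_card_fiberwise (f := σ) (t := univ) (fun _ _ => mem_univ _)]
  refine sum_congr rfl fun a _ => ?_
  rw [offCount, filter_filter]
  congr 1
  ext i
  simp only [mem_filter, mem_univ, true_and, ne_eq, Equiv.eq_symm_apply]
  grind

/-- Matching each column with its largest row among those preferring it: every row is either
matched with its preferred column, or shares that column with a row at least as large there. -/
lemma exists_perm_forall_eq_or_exists_le (r : Fin K → Fin K) (x : Fin K → ℕ) :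
    ∃ ρ : Equiv.Perm (Fin K), ∀ a, ρ.symm a = r a ∨ ∃ c, a ≠ c ∧ r c = r a ∧ x a ≤ x c := by
  have hs : ∀ b, ∃ a, b ∈ univ.image r → r a = b ∧ ∀ c, r c = b → x c ≤ x a := by
    intro b
    by_cases hb : b ∈ univ.image r
    · obtain ⟨a₀, -, ha₀⟩ := mem_image.1 hb
      obtain ⟨a, ha, hmax⟩ := exists_max_image (univ.filter fun a => r a = b) x
        ⟨a₀, by simpa using ha₀⟩
      exact ⟨a, fun _ => ⟨(mem_filter.1 ha).2, fun c hc => hmax c (by simpa using hc)⟩⟩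
    · exact ⟨b, fun h => absurd h hb⟩
  choose s hs using hs
  have hinj : Set.InjOn s (univ.image r : Finset (Fin K)) := fun b hb c hc h => by
    rw [← (hs b hb).1, ← (hs c hc).1, h]
  obtain ⟨g, hg⟩ := exists_equiv_extend_of_card_eq (t := (univ : Finset (Fin K)))
    (by simp) (subset_univ _) hinj
  refine ⟨g.trans (Equiv.subtypeUnivEquiv mem_univ), fun a => ?_⟩
  have hra : r a ∈ univ.image r := mem_image_of_mem r (mem_univ a)
  by_cases h : a = s (r a)
  · left
    rw [Equiv.symm_apply_eq]
    exact h.trans (hg _ hra).symm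
  · exact Or.inr ⟨s (r a), h, (hs _ hra).1, (hs _ hra).2 a rfl⟩

lemma sub_hamStar_mul_hamStar_le {m : ℝ} (hm : ∀ a, m ≤ blockCount σ a) :
    (m - hamStar σ σ') * hamStar σ σ' ≤ ((pairSet σ \ pairSet σ').card : ℝ) := by
  obtain ⟨ρ, -, hρ⟩ := exists_mem_eq_inf' (univ_nonempty (α := Equiv.Perm (Fin K)))
    fun ρ => ham σ (fun i => ρ (σ' i))
  have hH : hamStar σ σ' = ∑ a, offCount σ σ' a (ρ.symm a) := hρ.trans (ham_comp_perm σ σ' ρ)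
  have hD : 2 * ((pairSet σ \ pairSet σ').card : ℝ) = ∑ a, (rowSplit σ σ' a : ℝ) := by
    exact_mod_cast two_mul_card_pairSet_sdiff σ σ'
  have hrow : ∑ a, 2 * ((m - hamStar σ σ') * (offCount σ σ' a (ρ.symm a) : ℝ)) ≤
      ∑ a, (rowSplit σ σ' a : ℝ) := by
    refine sum_le_sum fun a _ => ?_
    have h₁ : (2 * (cellCount σ σ' a (ρ.symm a) * offCount σ σ' a (ρ.symm a)) : ℝ) ≤
        rowSplit σ σ' a := by
      exact_mod_cast two_mul_cellCount_mul_offCount_le_rowSplit σ σ' a (ρ.symm a)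
    have h₂ : (cellCount σ σ' a (ρ.symm a) + offCount σ σ' a (ρ.symm a) : ℝ) =
        blockCount σ a := by
      exact_mod_cast cellCount_add_offCount σ σ' a (ρ.symm a)
    have h₃ : (offCount σ σ' a (ρ.symm a) : ℝ) ≤ hamStar σ σ' := by
      rw [hH]
      exact_mod_cast single_le_sum (f := fun a => offCount σ σ' a (ρ.symm a))
        (fun _ _ => Nat.zero_le _) (mem_univ a)
    have h₄ : m - hamStar σ σ' ≤ (cellCount σ σ' a (ρ.symm a) : ℝ) := by
      linarith [hm a]
    linarith [mul_le_mul_of_nonneg_right h₄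
      (Nat.cast_nonneg (α := ℝ) (offCount σ σ' a (ρ.symm a)))]
  rw [← mul_sum, ← mul_sum, ← Nat.cast_sum, ← hH] at hrow
  linarith

lemma third_sub_sixth_mul_hamStar_le {m M : ℝ} (hm : ∀ a, m ≤ blockCount σ a)
    (hM : ∀ b, (blockCount σ' b : ℝ) ≤ M) :
    ((1 / 3) * m - (1 / 6) * M) * hamStar σ σ' ≤ ((pairSet σ \ pairSet σ').card : ℝ) := by
  rcases le_total ((1 / 3) * m - (1 / 6) * M) 0 with hneg | hpos
  · exact (mul_nonpos_of_nonpos_of_nonneg hneg (Nat.cast_nonneg _)).trans (Nat.cast_nonneg _)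
  have hr : ∀ a, ∃ b, ∀ c, offCount σ σ' a b ≤ offCount σ σ' a c := fun a => by
    obtain ⟨b, -, hb⟩ := exists_min_image univ (offCount σ σ' a) ⟨a, mem_univ a⟩
    exact ⟨b, fun c => hb c (mem_univ c)⟩
  choose r hr using hr
  obtain ⟨ρ, hρ⟩ := exists_perm_forall_eq_or_exists_le r fun a => cellCount σ σ' a (r a)
  have hH : (hamStar σ σ' : ℝ) ≤ ∑ a, (offCount σ σ' a (ρ.symm a) : ℝ) := by
    have h : hamStar σ σ' ≤ ham σ (fun i => ρ (σ' i)) := inf'_le _ (mem_univ ρ)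
    rw [ham_comp_perm] at h
    exact_mod_cast h
  have hD : 2 * ((pairSet σ \ pairSet σ').card : ℝ) = ∑ a, (rowSplit σ σ' a : ℝ) := by
    exact_mod_cast two_mul_card_pairSet_sdiff σ σ'
  have hrow : ∑ a, 2 * (((1 / 3) * m - (1 / 6) * M) * (offCount σ σ' a (ρ.symm a) : ℝ)) ≤
      ∑ a, (rowSplit σ σ' a : ℝ) := by
    refine sum_le_sum fun a _ => ?_
    have hM0 : 0 ≤ M := (Nat.cast_nonneg _).trans (hM a)
    have h₁ : (blockCount σ a * offCount σ σ' a (r a) : ℝ) ≤ rowSplit σ σ' a := by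
      exact_mod_cast blockCount_mul_offCount_le_rowSplit σ σ' (hr a)
    have h₂ : (cellCount σ σ' a (r a) + offCount σ σ' a (r a) : ℝ) = blockCount σ a := by
      exact_mod_cast cellCount_add_offCount σ σ' a (r a)
    rcases hρ a with h | ⟨c, hac, hrc, hle⟩
    · rw [h]
      have h₃ : 2 * ((1 / 3) * m - (1 / 6) * M) ≤ (blockCount σ a : ℝ) := by
        linarith [hm a]
      linarith [mul_le_mul_of_nonneg_right h₃
        (Nat.cast_nonneg (α := ℝ) (offCount σ σ' a (r a)))]
    · rw [hrc] at hle
      have h₃ : (cellCount σ σ' a (r a) + cellCount σ σ' c (r a) : ℝ) ≤ M :=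
        le_trans (by exact_mod_cast cellCount_add_cellCount_le σ σ' hac (r a)) (hM (r a))
      have h₄ : (cellCount σ σ' a (r a) : ℝ) ≤ cellCount σ σ' c (r a) := by exact_mod_cast hle
      have h₅ : 2 * ((1 / 3) * m - (1 / 6) * M) ≤ (offCount σ σ' a (r a) : ℝ) := by
        linarith [hm a]
      have h₆ : (offCount σ σ' a (ρ.symm a) : ℝ) ≤ blockCount σ a := by
        exact_mod_cast le_of_add_le_right (cellCount_add_offCount σ σ' a (ρ.symm a)).le
      have h₇ := mul_le_mul h₅ h₆ (Nat.cast_nonneg _) (Nat.cast_nonneg _)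
      linarith
  rw [← mul_sum, ← mul_sum] at hrow
  linarith [mul_le_mul_of_nonneg_left hH hpos]

end

/-- `|E(σ) \ E(σ')| ≥ max{N_min^σ − Ham*(σ,σ'), N_min^σ/3 − N_max^{σ'}/6} ⬝ Ham*(σ,σ')`. -/
theorem pair_diff_lower_bound_via_hamStar
    (N K : ℕ) [NeZero K] (σ σ' : Fin N → Fin K) :
    (((pairSet σ) \ (pairSet σ')).card : ℝ) ≥
      max (((Finset.univ.inf' Finset.univ_nonempty fun k => blockCount σ k : ℕ) : ℝ) -
            (hamStar σ σ' : ℝ))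
          ((1 / 3) * ((Finset.univ.inf' Finset.univ_nonempty fun k => blockCount σ k : ℕ) : ℝ) -
            (1 / 6) * ((Finset.univ.sup' Finset.univ_nonempty fun k => blockCount σ' k : ℕ) : ℝ)) *
        (hamStar σ σ' : ℝ) := by
  have hm : ∀ a, ((univ.inf' univ_nonempty fun k => blockCount σ k : ℕ) : ℝ) ≤
      blockCount σ a := fun a => by
    exact_mod_cast inf'_le (fun k => blockCount σ k) (mem_univ a)
  have hM : ∀ b, (blockCount σ' b : ℝ) ≤
      ((univ.sup' univ_nonempty fun k => blockCount σ' k : ℕ) : ℝ) := fun b => by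
    exact_mod_cast le_sup' (fun k => blockCount σ' k) (mem_univ b)
  rw [ge_iff_le, max_mul_of_nonneg _ _ (Nat.cast_nonneg _)]
  exact max_le (sub_hamStar_mul_hamStar_le σ σ' hm) (third_sub_sixth_mul_hamStar_le σ σ' hm hM)
end

section
/- Consider the homogeneous stochastic block model with N nodes, K blocks and probability mass functions f, g on a finite set S, and let I = D_{1/2}(f‖g) = −2 log ∑_{x∈S} √(f(x) g(x)). Then for all node labellings σ, σ' : {1,…,N} → {1,…,K}, P_σ{ x : P_{σ'}(x) ≥ P_σ(x) } ≤ exp(−(1/4) Mir(σ, σ') · I). -/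
open Finset
open scoped Classical

/-- Index type for unordered pairs of distinct nodes, represented by ordered pairs `i < j`. -/
abbrev PairIdx (N : ℕ) := {p : Fin N × Fin N // p.1 < p.2}

/-- Probability assigned by the homogeneous SBM with labelling `σ`, intra-block interaction
distribution `f` and inter-block interaction distribution `g`, to the data array `x`. -/
noncomputable def sbmProb {N K : ℕ} {S : Type*} [Fintype S] (f g : S → ℝ)
    (σ : Fin N → Fin K) (x : PairIdx N → S) : ℝ :=
  ∏ p : PairIdx N, (if σ p.1.1 = σ p.1.2 then f (x p) else g (x p))

/-- Mirkin distance between two node labellings. -/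
def mirkin {N K : ℕ} (σ σ' : Fin N → Fin K) : ℕ :=
  2 * (((pairSet σ) \ (pairSet σ')).card + ((pairSet σ') \ (pairSet σ)).card)

/-- The Mirkin distance is twice the number of node pairs on which the labellings disagree. -/
theorem mirkin_eq_two_mul_card_filter {N K : ℕ} (σ σ' : Fin N → Fin K) :
    mirkin σ σ' = 2 * (Finset.univ.filter fun p : PairIdx N =>
      ¬ (σ p.1.1 = σ p.1.2 ↔ σ' p.1.1 = σ' p.1.2)).card := by
  unfold mirkin
  rw [← Finset.card_union_of_disjoint disjoint_sdiff_sdiff,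
    ← Finset.card_map (Function.Embedding.subtype _)]
  congr 2
  ext p
  simp only [pairSet, Finset.mem_union, Finset.mem_sdiff, Finset.mem_filter, Finset.mem_univ,
    Finset.mem_map, Function.Embedding.subtype_apply, Subtype.exists, true_and,
    exists_and_right, exists_eq_right, exists_prop]
  tauto

theorem sbmProb_nonneg {N K : ℕ} {S : Type*} [Fintype S] {f g : S → ℝ}
    (hf0 : ∀ x, 0 ≤ f x) (hg0 : ∀ x, 0 ≤ g x) (σ : Fin N → Fin K) (x : PairIdx N → S) :
    0 ≤ sbmProb f g σ x :=
  Finset.prod_nonneg fun p _ => by split_ifs <;> simp [hf0, hg0]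

/-- The Bhattacharyya coefficient of two homogeneous SBMs is a power of that of `f` and `g`. -/
theorem sum_sqrt_sbmProb_mul {N K : ℕ} {S : Type*} [Fintype S] {f g : S → ℝ}
    (hf0 : ∀ x, 0 ≤ f x) (hg0 : ∀ x, 0 ≤ g x) (hf1 : ∑ x, f x = 1) (hg1 : ∑ x, g x = 1)
    (σ σ' : Fin N → Fin K) :
    ∑ x, Real.sqrt (sbmProb f g σ x * sbmProb f g σ' x) =
      (∑ x, Real.sqrt (f x * g x)) ^ (Finset.univ.filter fun p : PairIdx N =>
        ¬ (σ p.1.1 = σ p.1.2 ↔ σ' p.1.1 = σ' p.1.2)).card := by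
  have hfactor (x : PairIdx N → S) : Real.sqrt (sbmProb f g σ x * sbmProb f g σ' x) =
      ∏ p : PairIdx N, Real.sqrt ((if σ p.1.1 = σ p.1.2 then f (x p) else g (x p)) *
        (if σ' p.1.1 = σ' p.1.2 then f (x p) else g (x p))) := by
    unfold sbmProb
    rw [← Finset.prod_mul_distrib, Real.sqrt_prod]
    intro p _
    apply mul_nonneg <;> split_ifs <;> simp [hf0, hg0]
  simp_rw [hfactor]
  rw [← Fintype.piFinset_univ, ← Finset.prod_univ_sum (fun _ : PairIdx N => Finset.univ)
    (fun p s => Real.sqrt ((if σ p.1.1 = σ p.1.2 then f s else g s) *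
        (if σ' p.1.1 = σ' p.1.2 then f s else g s))),
    ← Finset.prod_const, Finset.prod_filter]
  refine Finset.prod_congr rfl fun p _ => ?_
  by_cases h : σ p.1.1 = σ p.1.2 <;> by_cases h' : σ' p.1.1 = σ' p.1.2 <;>
    simp [h, h', hf0, hg0, hf1, hg1, Real.sqrt_mul_self, mul_comm]

/-- For a homogeneous SBM, the probability that the labelling `σ'` is at least as likely as the
true labelling `σ` is at most `exp(−(1/4) Mir(σ,σ') I)` with `I = D_{1/2}(f‖g)`. -/
theorem mirkin_likelihood_bound
    (N K : ℕ) (S : Type*) [Fintype S]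
    (f g : S → ℝ) (hf0 : ∀ x, 0 ≤ f x) (hg0 : ∀ x, 0 ≤ g x)
    (hf1 : ∑ x, f x = 1) (hg1 : ∑ x, g x = 1)
    (I : ℝ) (hI : I = -2 * Real.log (∑ x, Real.sqrt (f x * g x)))
    (σ σ' : Fin N → Fin K) :
    (∑ x ∈ Finset.univ.filter (fun x : PairIdx N → S => sbmProb f g σ' x ≥ sbmProb f g σ x),
        sbmProb f g σ x)
      ≤ Real.exp (-(1 / 4) * (mirkin σ σ' : ℝ) * I) := by
  set B := ∑ x, Real.sqrt (f x * g x) with hB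
  have hB0 : 0 ≤ B := Finset.sum_nonneg fun _ _ => Real.sqrt_nonneg _
  have hP := sbmProb_nonneg (N := N) (K := K) hf0 hg0
  calc
    _ ≤ ∑ x ∈ Finset.univ.filter (fun x : PairIdx N → S => sbmProb f g σ' x ≥ sbmProb f g σ x),
          Real.sqrt (sbmProb f g σ x * sbmProb f g σ' x) := by
      refine Finset.sum_le_sum fun x hx => Real.le_sqrt_of_sq_le ?_
      rw [sq]
      exact mul_le_mul_of_nonneg_left (Finset.mem_filter.mp hx).2 (hP σ x)
    _ ≤ ∑ x, Real.sqrt (sbmProb f g σ x * sbmProb f g σ' x) :=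
      Finset.sum_le_sum_of_subset_of_nonneg (Finset.filter_subset _ _)
        fun _ _ _ => Real.sqrt_nonneg _
    _ = B ^ _ := sum_sqrt_sbmProb_mul hf0 hg0 hf1 hg1 σ σ'
    _ ≤ _ := by
      rw [hI, mirkin_eq_two_mul_card_filter, Nat.cast_mul, Nat.cast_ofNat]
      generalize Finset.card _ = d
      rw [show -(1 / 4) * (2 * (d : ℝ)) * (-2 * Real.log B) = d * Real.log B by ring,
        Real.exp_nat_mul]
      exact pow_le_pow_left₀ hB0 (Real.le_exp_log B) d
end

section
/- Let N, K ≥ 1, let S be a finite set, and for k, ℓ ∈ {1,…,K} let f_{kℓ} be strictly positive probability mass functions on S with f_{kℓ} = f_{ℓk}. Let α be a probability vector on {1,…,K} with all α_k > 0 and α_min = min_k α_k, and let the random pair (σ, x) have joint law P(σ, x) = (∏_{i=1}^N α_{σ(i)}) ∏_{1≤i<j≤N} f_{σ(i)σ(j)}(x_{ij}) on the product of {1,…,K}^N and the set X of symmetric S-valued arrays. Fix a subset 𝒦 ⊂ {1,…,K} and strictly positive probability mass functions f*_1,…,f*_K on S. Set α_𝒦 = ∑_{k∈𝒦} α_k,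 α_{max,𝒦} = max_{k∈𝒦} α_k, δ = (1/4)(α_𝒦 − α_{max,𝒦}), and assume δ > 0 and N ≥ 8 α_min^{-1} log(K/δ). Define α*_k = 1(k ∈ 𝒦) α_k/α_𝒦, A_k = ∑_ℓ α_ℓ d_KL(f*_ℓ ‖ f_{kℓ}), B_k = ∑_ℓ α_ℓ d_KL(f*_ℓ ‖ f_{kℓ})² − A_k², I_1 = ∑_k ∑_ℓ α*_k α_ℓ d_KL(f*_ℓ ‖ f_{kℓ}), I_21 = ∑_k ∑_ℓ α*_k α_ℓ v_KL(f*_ℓ ‖ f_{kℓ}) + ∑_k α*_k B_k, and I_22 = ∑_k α*_k A_k² − (∑_k α*_k A_k)². Then for every estimator σ̂ : X → {1,…,K}^N, E Ham*(σ, σ̂(x)) ≥ (1/21) N α_min² δ exp(−N I_1 − α_𝒦^{1/2} δ^{-1/2} √(N I_21 + N² I_22)) − (1/6) N α_min K exp(−N α_min / 8). -/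
open Finset

/-- Kullback–Leibler divergence between probability mass functions on a finite set. -/
noncomputable def dKL {S : Type*} [Fintype S] (p q : S → ℝ) : ℝ :=
  ∑ x, p x * Real.log (p x / q x)

/-- Variance-type KL functional `v_KL(p‖q) = ∑ p log²(p/q) − d_KL(p‖q)²`. -/
noncomputable def vKL {S : Type*} [Fintype S] (p q : S → ℝ) : ℝ :=
  (∑ x, p x * (Real.log (p x / q x)) ^ 2) - (dKL p q) ^ 2

section WeightedProducts

variable {ι T : Type*} [Fintype ι] [DecidableEq ι] [Fintype T]

theorem sum_pi_prod (w : ι → T → ℝ) :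
    ∑ y : ι → T, ∏ j, w j (y j) = ∏ j, ∑ t, w j t := by
  classical
  rw [Finset.prod_univ_sum, Fintype.piFinset_univ]

theorem sum_pi_prod_eq_one {w : ι → T → ℝ} (hw : ∀ j, ∑ t, w j t = 1) :
    ∑ y : ι → T, ∏ j, w j (y j) = 1 := by
  rw [sum_pi_prod]; simp [hw]

/-- The expectation of a function of one coordinate under a product weight. -/
theorem sum_pi_prod_mul_apply {w : ι → T → ℝ} (hw : ∀ j, ∑ t, w j t = 1) (i : ι) (h : T → ℝ) :
    ∑ y : ι → T, (∏ j, w j (y j)) * h (y i) = ∑ t, w i t * h t := by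
  have key : ∀ y : ι → T, (∏ j, w j (y j)) * h (y i)
      = ∏ j, (w j (y j) * if j = i then h (y j) else 1) := by
    intro y
    rw [Finset.prod_mul_distrib]; simp
  simp_rw [key]
  rw [sum_pi_prod (fun j t => w j t * if j = i then h t else 1),
    Finset.prod_eq_single i]
  · simp
  · intro j _ hj
    simp [hj, hw]
  · simp

/-- Functions of two distinct coordinates are uncorrelated under a product weight. -/
theorem sum_pi_prod_mul_apply_mul_apply {w : ι → T → ℝ} (hw : ∀ j, ∑ t, w j t = 1)
    {i i' : ι} (hne : i ≠ i') (h h' : T → ℝ) :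
    ∑ y : ι → T, (∏ j, w j (y j)) * (h (y i) * h' (y i'))
      = (∑ t, w i t * h t) * ∑ t, w i' t * h' t := by
  have key : ∀ y : ι → T, (∏ j, w j (y j)) * (h (y i) * h' (y i'))
      = ∏ j, (w j (y j) * ((if j = i then h (y j) else 1) * if j = i' then h' (y j) else 1)) := by
    intro y
    rw [Finset.prod_mul_distrib, Finset.prod_mul_distrib]; simp
  simp_rw [key]
  rw [sum_pi_prod (fun j t => w j t * ((if j = i then h t else 1) * if j = i' then h' t else 1))]
  have fac : ∀ j, ∑ t, w j t * ((if j = i then h t else 1) * if j = i' then h' t else 1)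
      = (if j = i then ∑ t, w j t * h t else 1) * if j = i' then ∑ t, w j t * h' t else 1 := by
    intro j
    by_cases h1 : j = i
    · have h2 : j ≠ i' := fun h2 => hne (h1.symm.trans h2)
      simp [h1, hne]
    · by_cases h2 : j = i' <;> simp [h1, h2, hw, hne.symm]
  simp_rw [fac, Finset.prod_mul_distrib]
  simp

/-- Mean of a sum of functions of the coordinates under a product weight. -/
theorem sum_pi_prod_mul_sum {w : ι → T → ℝ} (hw : ∀ j, ∑ t, w j t = 1) (h : ι → T → ℝ) :
    ∑ y : ι → T, (∏ j, w j (y j)) * ∑ j, h j (y j) = ∑ j, ∑ t, w j t * h j t := by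
  simp_rw [Finset.mul_sum]
  rw [Finset.sum_comm]
  exact Finset.sum_congr rfl fun j _ => sum_pi_prod_mul_apply hw j (h j)

/-- Bias-variance decomposition for a sum of functions of independent coordinates. -/
theorem sum_pi_prod_mul_sum_sub_sq {w : ι → T → ℝ} (hw : ∀ j, ∑ t, w j t = 1)
    (h : ι → T → ℝ) (c : ℝ) :
    ∑ y : ι → T, (∏ j, w j (y j)) * (∑ j, h j (y j) - c) ^ 2
      = ∑ j, (∑ t, w j t * h j t ^ 2 - (∑ t, w j t * h j t) ^ 2)
        + (∑ j, ∑ t, w j t * h j t - c) ^ 2 := by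
  set m : ι → ℝ := fun j => ∑ t, w j t * h j t with hm
  have second : ∑ y : ι → T, (∏ j, w j (y j)) * (∑ j, h j (y j)) ^ 2
      = ∑ j, (∑ t, w j t * h j t ^ 2 - m j ^ 2) + (∑ j, m j) ^ 2 := by
    have cross : ∀ i i', ∑ y : ι → T, (∏ j, w j (y j)) * (h i (y i) * h i' (y i'))
        = (if i = i' then ∑ t, w i t * h i t ^ 2 - m i ^ 2 else 0) + m i * m i' := by
      intro i i'
      by_cases hii : i = i'
      · subst hii
        have := sum_pi_prod_mul_apply hw i (fun t => h i t ^ 2)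
        simp only [← pow_two, this, if_true]
        ring
      · rw [sum_pi_prod_mul_apply_mul_apply hw hii]
        simp [hii, hm]
    have expand : ∀ y : ι → T, (∏ j, w j (y j)) * (∑ j, h j (y j)) ^ 2
        = ∑ i, ∑ i', (∏ j, w j (y j)) * (h i (y i) * h i' (y i')) := by
      intro y
      rw [pow_two, Finset.sum_mul_sum, Finset.mul_sum]
      simp_rw [Finset.mul_sum]
    simp_rw [expand]
    rw [Finset.sum_comm]
    have : ∀ i, ∑ y : ι → T, ∑ i', (∏ j, w j (y j)) * (h i (y i) * h i' (y i'))
        = (∑ t, w i t * h i t ^ 2 - m i ^ 2) + m i * ∑ i', m i' := by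
      intro i
      rw [Finset.sum_comm]
      simp_rw [cross, Finset.sum_add_distrib, ← Finset.mul_sum]
      simp
    simp_rw [this, Finset.sum_add_distrib, ← Finset.sum_mul]
    ring
  have split : ∀ y : ι → T, (∏ j, w j (y j)) * (∑ j, h j (y j) - c) ^ 2
      = (∏ j, w j (y j)) * (∑ j, h j (y j)) ^ 2
        - 2 * c * ((∏ j, w j (y j)) * ∑ j, h j (y j)) + c ^ 2 * ∏ j, w j (y j) := by
    intro y; ring
  simp_rw [split, Finset.sum_add_distrib, Finset.sum_sub_distrib, ← Finset.mul_sum]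
  rw [second, sum_pi_prod_mul_sum hw, sum_pi_prod_eq_one hw]
  change _ - 2 * c * ∑ j, m j + _ = _
  simp_rw [Finset.sum_sub_distrib]
  ring

/-- Replacing one coordinate by an independent copy does not change the law. -/
theorem sum_pi_prod_mul_eq_sum_update {a : T → ℝ} (ha : ∑ t, a t = 1) (i : ι)
    (G : (ι → T) → ℝ) :
    ∑ y : ι → T, (∏ j, a (y j)) * G y
      = ∑ k, a k * ∑ y : ι → T, (∏ j, a (y j)) * G (Function.update y i k) := by
  have lhs : ∑ y : ι → T, (∏ j, a (y j)) * G y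
      = ∑ p : T × (ι → T), a p.1 * ((∏ j, a (p.2 j)) * G p.2) := by
    rw [Fintype.sum_prod_type]
    simp_rw [← Finset.mul_sum]
    rw [← Finset.sum_mul, ha, one_mul]
  have rhs : ∑ k, a k * ∑ y : ι → T, (∏ j, a (y j)) * G (Function.update y i k)
      = ∑ p : T × (ι → T), a p.1 * ((∏ j, a (p.2 j)) * G (Function.update p.2 i p.1)) := by
    rw [Fintype.sum_prod_type]
    simp_rw [← Finset.mul_sum]
  rw [lhs, rhs]
  refine Finset.sum_nbij' (fun p => (p.2 i, Function.update p.2 i p.1))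
    (fun p => (p.2 i, Function.update p.2 i p.1)) (by simp) (by simp) (by simp) (by simp) ?_
  rintro ⟨k, y⟩ -
  have h1 : ∏ j, a (y j) = a (y i) * ∏ j ∈ Finset.univ.erase i, a (y j) :=
    (Finset.mul_prod_erase _ _ (Finset.mem_univ i)).symm
  have h2 : ∏ j, a (Function.update y i k j) = a k * ∏ j ∈ Finset.univ.erase i, a (y j) := by
    rw [← Finset.mul_prod_erase _ _ (Finset.mem_univ i), Function.update_self]
    congr 1
    refine Finset.prod_congr rfl fun j hj => ?_
    rw [Function.update_of_ne (Finset.ne_of_mem_erase hj)]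
  simp only [Function.update_idem, Function.update_eq_self]
  rw [h1, h2]
  ring

end WeightedProducts

theorem sum_mul_sq_sub_sq_nonneg {T : Type*} [Fintype T] {w : T → ℝ} (hw0 : ∀ t, 0 ≤ w t)
    (hw : ∑ t, w t = 1) (h : T → ℝ) :
    0 ≤ ∑ t, w t * h t ^ 2 - (∑ t, w t * h t) ^ 2 := by
  set m := ∑ t, w t * h t with hm
  have key : ∑ t, w t * (h t - m) ^ 2 = ∑ t, w t * h t ^ 2 - m ^ 2 := by
    have : ∀ t, w t * (h t - m) ^ 2 = w t * h t ^ 2 - 2 * m * (w t * h t) + m ^ 2 * w t := by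
      intro t; ring
    simp_rw [this, Finset.sum_add_distrib, Finset.sum_sub_distrib, ← Finset.mul_sum]
    rw [hw, ← hm]; ring
  rw [← key]
  exact Finset.sum_nonneg fun t _ => mul_nonneg (hw0 t) (sq_nonneg _)

section Divergences

variable {S : Type*} [Fintype S] {p q : S → ℝ}

theorem dKL_nonneg (hp : ∀ x, 0 < p x) (hq : ∀ x, 0 < q x) (hp1 : ∑ x, p x = 1)
    (hq1 : ∑ x, q x = 1) : 0 ≤ dKL p q := by
  have h : ∑ x, (p x - q x) ≤ dKL p q := by
    refine Finset.sum_le_sum fun x _ => ?_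
    have hlog := Real.one_sub_inv_le_log_of_pos (div_pos (hp x) (hq x))
    calc p x - q x = p x * (1 - (p x / q x)⁻¹) := by
          have := (hp x).ne'
          field_simp
      _ ≤ _ := mul_le_mul_of_nonneg_left hlog (hp x).le
  rwa [Finset.sum_sub_distrib, hp1, hq1, sub_self] at h

theorem vKL_nonneg (hp : ∀ x, 0 < p x) (hp1 : ∑ x, p x = 1) : 0 ≤ vKL p q :=
  sum_mul_sq_sub_sq_nonneg (fun x => (hp x).le) hp1 _

theorem dKL_self (hp : ∀ x, 0 < p x) : dKL p p = 0 := by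
  simp [dKL, div_self (hp _).ne']

theorem vKL_self (hp : ∀ x, 0 < p x) : vKL p p = 0 := by
  simp [vKL, dKL, div_self (ne_of_gt (hp _))]

/-- Product measures: the likelihood ratio as the exponential of the log-likelihood ratio. -/
theorem prod_eq_prod_mul_exp_neg_sum_log {ι : Type*} [Fintype ι] {a b : ι → ℝ}
    (ha : ∀ i, 0 < a i) (hb : ∀ i, 0 < b i) :
    ∏ i, b i = (∏ i, a i) * Real.exp (-∑ i, Real.log (a i / b i)) := by
  rw [← Finset.sum_neg_distrib, Real.exp_sum, ← Finset.prod_mul_distrib]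
  refine Finset.prod_congr rfl fun i _ => ?_
  rw [Real.exp_neg, Real.exp_log (div_pos (ha i) (hb i)), inv_div,
    mul_div_cancel₀ _ (ha i).ne']

end Divergences

/-- A sum over pairs whose terms vanish off the pairs containing `i`. -/
theorem sum_pairIdx_incident {N : ℕ} (i : Fin N) (Φ : Fin N → ℝ) :
    ∑ p : PairIdx N, (if p.1.1 = i then Φ p.1.2 else if p.1.2 = i then Φ p.1.1 else 0)
      = ∑ j, if j = i then 0 else Φ j := by
  have h1 : ∑ p : PairIdx N, (if p.1.1 = i then Φ p.1.2 else if p.1.2 = i then Φ p.1.1 else 0)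
      = ∑ p : Fin N × Fin N, ((if p.1 = i then (if i < p.2 then Φ p.2 else 0) else 0)
          + (if p.2 = i then (if p.1 < i then Φ p.1 else 0) else 0)) := by
    rw [← Finset.sum_subtype (Finset.univ.filter fun p : Fin N × Fin N => p.1 < p.2) (by simp)
      (fun p : Fin N × Fin N => if p.1 = i then Φ p.2 else if p.2 = i then Φ p.1 else 0),
      Finset.sum_filter]
    refine Finset.sum_congr rfl fun p _ => ?_
    by_cases ha : p.1 = i
    · by_cases hb : p.2 = i
      · simp [ha, hb]
      · simp [ha, hb]
    · by_cases hb : p.2 = i <;> simp [ha, hb]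
  rw [h1, Finset.sum_add_distrib, Fintype.sum_prod_type, Fintype.sum_prod_type_right]
  simp only [Finset.sum_ite_irrel, Finset.sum_const_zero, Finset.sum_ite_eq', Finset.mem_univ,
    if_true]
  rw [← Finset.sum_add_distrib]
  refine Finset.sum_congr rfl fun j _ => ?_
  rcases lt_trichotomy j i with h | h | h
  · simp [h, h.ne, h.not_gt]
  · simp [h]
  · simp [h, h.ne', h.not_gt]

/-- Hamming distance ignoring the node `i`. -/
def hamExcept {N K : ℕ} (i : Fin N) (σ₁ σ₂ : Fin N → Fin K) : ℕ :=
  (Finset.univ.filter fun j => j ≠ i ∧ σ₁ j ≠ σ₂ j).card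

/-- A relabelling of `τ` aligning it as well as possible with `σ` off the node `i`. -/
noncomputable def alignExcept {N K : ℕ} (i : Fin N) (σ τ : Fin N → Fin K) : Equiv.Perm (Fin K) :=
  (Finite.exists_min fun ρ : Equiv.Perm (Fin K) => hamExcept i σ (fun j => ρ (τ j))).choose

theorem hamExcept_alignExcept_le {N K : ℕ} (i : Fin N) (σ τ : Fin N → Fin K)
    (ρ : Equiv.Perm (Fin K)) :
    hamExcept i σ (fun j => alignExcept i σ τ (τ j)) ≤ hamExcept i σ (fun j => ρ (τ j)) :=
  (Finite.exists_min fun ρ : Equiv.Perm (Fin K) =>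
    hamExcept i σ (fun j => ρ (τ j))).choose_spec ρ

theorem hamExcept_update {N K : ℕ} (i : Fin N) (σ₁ σ₂ : Fin N → Fin K) (k : Fin K) :
    hamExcept i (Function.update σ₁ i k) σ₂ = hamExcept i σ₁ σ₂ := by
  unfold hamExcept
  congr 1
  refine Finset.filter_congr fun j _ => and_congr_right fun hj => ?_
  rw [Function.update_of_ne hj]

theorem alignExcept_update {N K : ℕ} (i : Fin N) (σ τ : Fin N → Fin K) (k : Fin K) :
    alignExcept i (Function.update σ i k) τ = alignExcept i σ τ := by
  unfold alignExcept
  simp only [hamExcept_update]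

theorem hamExcept_le_ham {N K : ℕ} (i : Fin N) (σ₁ σ₂ : Fin N → Fin K) :
    hamExcept i σ₁ σ₂ ≤ ham σ₁ σ₂ :=
  Finset.card_le_card fun j hj => by
    simp only [Finset.mem_filter, Finset.mem_univ, true_and] at hj ⊢
    exact hj.2

/-- Two distinct relabellings cannot both align `τ` well with `σ`. -/
theorem exists_card_block_le_of_ne {N K : ℕ} (i : Fin N) (σ τ : Fin N → Fin K)
    {ρ ρ' : Equiv.Perm (Fin K)} (hne : ρ ≠ ρ') :
    ∃ k, (Finset.univ.filter fun j => σ j = k).card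
      ≤ ham σ (fun j => ρ (τ j)) + hamExcept i σ (fun j => ρ' (τ j)) + 1 := by
  obtain ⟨m, hm⟩ : ∃ m, ρ m ≠ ρ' m := by
    by_contra! h
    exact hne (Equiv.ext h)
  refine ⟨ρ m, ?_⟩
  have hsub : (Finset.univ.filter fun j => σ j = ρ m)
      ⊆ (Finset.univ.filter fun j => σ j ≠ ρ (τ j))
        ∪ (Finset.univ.filter fun j => j ≠ i ∧ σ j ≠ ρ' (τ j)) ∪ {i} := by
    intro j hj
    simp only [Finset.mem_filter, Finset.mem_univ, true_and, Finset.mem_union,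
      Finset.mem_singleton] at hj ⊢
    by_cases hji : j = i
    · exact Or.inr hji
    · by_cases hjm : τ j = m
      · refine Or.inl (Or.inr ⟨hji, ?_⟩)
        rw [hj, hjm]
        exact hm
      · refine Or.inl (Or.inl ?_)
        rw [hj]
        exact fun h => hjm (ρ.injective h).symm
  refine (Finset.card_le_card hsub).trans ((Finset.card_union_le _ _).trans ?_)
  rw [Finset.card_singleton]
  exact Nat.add_le_add_right (Finset.card_union_le _ _) 1

/-- If all blocks of `σ` are large then either the absolute classification error is large, or it
counts the nodes misclassified after aligning the labels on the remaining nodes. -/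
theorem le_hamStar_or_hamStar_eq {N K : ℕ} (σ τ : Fin N → Fin K) (b : ℕ)
    (hb : ∀ k, b ≤ (Finset.univ.filter fun j => σ j = k).card) :
    b ≤ 2 * hamStar σ τ + 1 ∨
      hamStar σ τ = (Finset.univ.filter fun i => σ i ≠ alignExcept i σ τ (τ i)).card := by
  obtain ⟨ρ, -, hρ⟩ := Finset.exists_mem_eq_inf' (s := Finset.univ) Finset.univ_nonempty
    fun ρ : Equiv.Perm (Fin K) => ham σ (fun i => ρ (τ i))
  change hamStar σ τ = ham σ (fun i => ρ (τ i)) at hρ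
  by_cases h : ∀ i, alignExcept i σ τ = ρ
  · right
    simp only [hρ, h]
    rfl
  · left
    push Not at h
    obtain ⟨i, hi⟩ := h
    obtain ⟨k, hk⟩ := exists_card_block_le_of_ne i σ τ hi.symm
    have h1 := hamExcept_alignExcept_le i σ τ ρ
    have h2 := hamExcept_le_ham i σ (fun j => ρ (τ j))
    have h3 := hb k
    omega

/-- Chernoff bound: with high probability no block is smaller than half its minimal mean size. -/
theorem sum_prod_small_block_le {N K : ℕ} {α : Fin K → ℝ} (hα : ∀ k, 0 ≤ α k)
    (hα1 : ∑ k, α k = 1) {a : ℝ} (ha : ∀ k, a ≤ α k) :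
    ∑ σ : Fin N → Fin K, (∏ i, α (σ i)) *
        (if ∃ k, ((Finset.univ.filter fun j => σ j = k).card : ℝ) < N * a / 2 then 1 else 0)
      ≤ K * Real.exp (-(N : ℝ) * a / 8) := by
  have mgf : ∀ k, ∑ σ : Fin N → Fin K, (∏ i, α (σ i)) *
      (1 / 2 : ℝ) ^ (Finset.univ.filter fun j => σ j = k).card
      ≤ Real.exp (-(N : ℝ) * a / 2) := by
    intro k
    have h1 : ∀ σ : Fin N → Fin K, (∏ i, α (σ i)) *
        (1 / 2 : ℝ) ^ (Finset.univ.filter fun j => σ j = k).card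
        = ∏ i, (α (σ i) * if σ i = k then (1 / 2 : ℝ) else 1) := by
      intro σ
      rw [Finset.prod_mul_distrib, Finset.prod_ite]
      simp
    simp_rw [h1]
    rw [sum_pi_prod (fun _ l => α l * if l = k then (1 / 2 : ℝ) else 1)]
    have h2 : ∑ l, α l * (if l = k then (1 / 2 : ℝ) else 1) = 1 - α k / 2 := by
      have : ∀ l, α l * (if l = k then (1 / 2 : ℝ) else 1)
          = α l - if l = k then α l / 2 else 0 := by
        intro l; split_ifs <;> ring
      simp_rw [this, Finset.sum_sub_distrib, hα1]
      simp
    rw [h2, Finset.prod_const, Finset.card_univ, Fintype.card_fin]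
    have h3 : α k ≤ 1 := hα1 ▸ Finset.single_le_sum (fun l _ => hα l) (Finset.mem_univ k)
    calc (1 - α k / 2) ^ N ≤ (Real.exp (-(a / 2))) ^ N := by
          refine pow_le_pow_left₀ (by linarith) ?_ N
          have := Real.add_one_le_exp (-(a / 2))
          linarith [ha k]
      _ = _ := by rw [← Real.exp_nat_mul]; congr 1; ring
  have tail : ∀ k (σ : Fin N → Fin K),
      (if ((Finset.univ.filter fun j => σ j = k).card : ℝ) < N * a / 2 then (1 : ℝ) else 0)
        ≤ Real.exp (3 / 8 * (N * a)) *
          (1 / 2 : ℝ) ^ (Finset.univ.filter fun j => σ j = k).card := by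
    intro k σ
    split_ifs with h
    · have hpow : Real.exp (-(3 / 8 * (N * a))) ≤
          (1 / 2 : ℝ) ^ (Finset.univ.filter fun j => σ j = k).card := by
        have : (1 / 2 : ℝ) = Real.exp (-Real.log 2) := by
          rw [Real.exp_neg, Real.exp_log two_pos, one_div]
        rw [this, ← Real.exp_nat_mul]
        apply Real.exp_le_exp.2
        have hl : Real.log 2 ≤ 3 / 4 := by linarith [Real.log_two_lt_d9]
        have hl0 : 0 ≤ Real.log 2 := Real.log_nonneg one_le_two
        have hc : (0 : ℝ) ≤ ((Finset.univ.filter fun j => σ j = k).card : ℝ) := Nat.cast_nonneg _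
        nlinarith
      calc (1 : ℝ) = Real.exp (3 / 8 * (N * a)) * Real.exp (-(3 / 8 * (N * a))) := by
            rw [← Real.exp_add, add_neg_cancel, Real.exp_zero]
        _ ≤ _ := mul_le_mul_of_nonneg_left hpow (Real.exp_pos _).le
    · positivity
  have hprod : ∀ σ : Fin N → Fin K, 0 ≤ ∏ i, α (σ i) :=
    fun σ => Finset.prod_nonneg fun i _ => hα _
  calc _ ≤ ∑ σ : Fin N → Fin K, ∑ k, Real.exp (3 / 8 * (N * a)) * ((∏ i, α (σ i)) *
          (1 / 2 : ℝ) ^ (Finset.univ.filter fun j => σ j = k).card) := by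
        refine Finset.sum_le_sum fun σ _ => ?_
        have hun : (if ∃ k, ((Finset.univ.filter fun j => σ j = k).card : ℝ) < N * a / 2
            then (1 : ℝ) else 0) ≤ ∑ k, Real.exp (3 / 8 * (N * a)) *
              (1 / 2 : ℝ) ^ (Finset.univ.filter fun j => σ j = k).card := by
          split_ifs with h
          · obtain ⟨k, hk⟩ := h
            have := tail k σ
            rw [if_pos hk] at this
            refine this.trans (Finset.single_le_sum (f := fun k => Real.exp (3 / 8 * (N * a)) *
              (1 / 2 : ℝ) ^ (Finset.univ.filter fun j => σ j = k).card)
              (fun l _ => by positivity) (Finset.mem_univ k))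
          · exact Finset.sum_nonneg fun l _ => by positivity
        refine (mul_le_mul_of_nonneg_left hun (hprod σ)).trans (le_of_eq ?_)
        rw [Finset.mul_sum]
        exact Finset.sum_congr rfl fun k _ => by ring
    _ = ∑ k, Real.exp (3 / 8 * (N * a)) * ∑ σ : Fin N → Fin K, ((∏ i, α (σ i)) *
          (1 / 2 : ℝ) ^ (Finset.univ.filter fun j => σ j = k).card) := by
        rw [Finset.sum_comm]
        simp_rw [← Finset.mul_sum]
    _ ≤ ∑ _k : Fin K, Real.exp (3 / 8 * (N * a)) * Real.exp (-(N : ℝ) * a / 2) :=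
        Finset.sum_le_sum fun k _ => mul_le_mul_of_nonneg_left (mgf k) (Real.exp_pos _).le
    _ = _ := by
        rw [← Real.exp_add, Finset.sum_const, Finset.card_univ, Fintype.card_fin, nsmul_eq_mul]
        congr 2
        ring

/-- Chebyshev's inequality for a weighted finite sum, allowing zero variance. -/
theorem sum_mul_ite_lt_le {Ω : Type*} [Fintype Ω] {w : Ω → ℝ} (hw : ∀ ω, 0 ≤ w ω) (X : Ω → ℝ)
    {m V ε : ℝ} (hε : 0 < ε) (hV : ∑ ω, w ω * (X ω - m) ^ 2 ≤ V) :
    ∑ ω, w ω * (if m + (√ε)⁻¹ * √V < X ω then 1 else 0) ≤ ε := by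
  have hterm : ∀ ω, 0 ≤ w ω * (X ω - m) ^ 2 := fun ω => mul_nonneg (hw ω) (sq_nonneg _)
  rcases le_or_gt V 0 with hV0 | hV0
  · have hzero : ∀ ω, w ω * (X ω - m) ^ 2 = 0 := fun ω =>
      (Finset.sum_eq_zero_iff_of_nonneg fun ω _ => hterm ω).1
        (le_antisymm (hV.trans hV0) (Finset.sum_nonneg fun ω _ => hterm ω)) ω (Finset.mem_univ ω)
    refine le_trans (le_of_eq (Finset.sum_eq_zero fun ω _ => ?_)) hε.le
    split_ifs with h
    · rw [Real.sqrt_eq_zero_of_nonpos hV0, mul_zero, add_zero] at h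
      rcases mul_eq_zero.1 (hzero ω) with h0 | h0
      · simp [h0]
      · exact absurd (pow_eq_zero_iff two_ne_zero |>.1 h0) (sub_pos.2 h).ne'
    · simp
  · calc _ ≤ ∑ ω, ε / V * (w ω * (X ω - m) ^ 2) := by
          refine Finset.sum_le_sum fun ω _ => ?_
          split_ifs with h
          · have hs : (0 : ℝ) ≤ (√ε)⁻¹ * √V := by positivity
            have hsq : ((√ε)⁻¹ * √V) ^ 2 ≤ (X ω - m) ^ 2 :=
              pow_le_pow_left₀ hs (by linarith) 2
            rw [mul_pow, inv_pow, Real.sq_sqrt hε.le, Real.sq_sqrt hV0.le] at hsq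
            have h1 : 1 ≤ ε / V * (X ω - m) ^ 2 := by
              calc (1 : ℝ) = ε / V * (ε⁻¹ * V) := by field_simp
                _ ≤ _ := mul_le_mul_of_nonneg_left hsq (by positivity)
            calc w ω * 1 ≤ w ω * (ε / V * (X ω - m) ^ 2) :=
                  mul_le_mul_of_nonneg_left h1 (hw ω)
              _ = _ := by ring
          · have := hterm ω
            simp only [mul_zero]
            positivity
      _ ≤ ε / V * V := by
          rw [← Finset.mul_sum]
          exact mul_le_mul_of_nonneg_left hV (by positivity)
      _ = ε := by field_simp

/-- Change of measure: a label drawn from `b` independently of the observation `ω` cannot be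
guessed, hence neither can a label under a law with log-likelihood ratio `L`. -/
theorem exp_mul_le_sum_guess_error {κ Ω : Type*} [Fintype κ] [DecidableEq κ] [Fintype Ω]
    {q : Ω → ℝ} (hq0 : ∀ ω, 0 ≤ q ω) (hq1 : ∑ ω, q ω = 1)
    {b : κ → ℝ} (hb0 : ∀ k, 0 ≤ b k) (hb1 : ∑ k, b k = 1) (L : κ → Ω → ℝ) (ψ : Ω → κ)
    {m V ε : ℝ} (hε : 0 < ε) (hb : ∀ k, b k ≤ 1 - 4 * ε)
    (hV : ∑ k, b k * ∑ ω, q ω * (L k ω - m) ^ 2 ≤ V) :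
    3 * ε * Real.exp (-m - (√ε)⁻¹ * √V)
      ≤ ∑ k, b k * ∑ ω, q ω * Real.exp (-L k ω) * (if k ≠ ψ ω then 1 else 0) := by
  set t := m + (√ε)⁻¹ * √V with ht
  have cheb : ∑ k, b k * ∑ ω, q ω * (if t < L k ω then 1 else 0) ≤ ε := by
    have := sum_mul_ite_lt_le (w := fun p : κ × Ω => b p.1 * q p.2)
      (fun p => mul_nonneg (hb0 _) (hq0 _)) (fun p => L p.1 p.2) (m := m) (V := V) hε
      (by rw [Fintype.sum_prod_type]; simpa only [mul_assoc, ← Finset.mul_sum] using hV)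
    rw [Fintype.sum_prod_type] at this
    simpa only [mul_assoc, ← Finset.mul_sum] using this
  have guess : 4 * ε ≤ ∑ k, b k * ∑ ω, q ω * (if k ≠ ψ ω then 1 else 0) := by
    have h1 : ∑ k, b k * ∑ ω, q ω * (if k ≠ ψ ω then 1 else 0)
        = ∑ ω, q ω * (1 - b (ψ ω)) := by
      simp_rw [Finset.mul_sum]
      rw [Finset.sum_comm]
      refine Finset.sum_congr rfl fun ω _ => ?_
      have h2 : ∀ k, b k * (q ω * (if k ≠ ψ ω then 1 else 0))
          = q ω * (b k - if k = ψ ω then b k else 0) := by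
        intro k
        by_cases h : k = ψ ω <;> simp [h, mul_comm]
      simp_rw [h2, ← Finset.mul_sum, Finset.sum_sub_distrib, hb1]
      simp
    rw [h1]
    calc 4 * ε = ∑ ω, q ω * (4 * ε) := by rw [← Finset.sum_mul, hq1, one_mul]
      _ ≤ _ := Finset.sum_le_sum fun ω _ =>
        mul_le_mul_of_nonneg_left (by linarith [hb (ψ ω)]) (hq0 ω)
  have ptwise : ∀ k ω, Real.exp (-t) * ((if k ≠ ψ ω then 1 else 0) - if t < L k ω then 1 else 0)
      ≤ Real.exp (-L k ω) * (if k ≠ ψ ω then 1 else 0) := by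
    intro k ω
    by_cases hL : t < L k ω
    · have h1 : (0 : ℝ) ≤ Real.exp (-L k ω) * (if k ≠ ψ ω then 1 else 0) := by positivity
      refine le_trans ?_ h1
      refine mul_nonpos_of_nonneg_of_nonpos (Real.exp_pos _).le ?_
      rw [if_pos hL]
      split_ifs <;> norm_num
    · rw [if_neg hL, sub_zero]
      refine mul_le_mul_of_nonneg_right ?_ (by positivity)
      exact Real.exp_le_exp.2 (by linarith)
  calc 3 * ε * Real.exp (-m - (√ε)⁻¹ * √V) = Real.exp (-t) * (4 * ε - ε) := by
        rw [ht, neg_add']; ring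
    _ ≤ Real.exp (-t) * (∑ k, b k * ∑ ω, q ω * (if k ≠ ψ ω then 1 else 0)
          - ∑ k, b k * ∑ ω, q ω * (if t < L k ω then 1 else 0)) :=
        mul_le_mul_of_nonneg_left (by linarith) (Real.exp_pos _).le
    _ = ∑ k, b k * ∑ ω, q ω * (Real.exp (-t) *
          ((if k ≠ ψ ω then 1 else 0) - if t < L k ω then 1 else 0)) := by
        rw [← Finset.sum_sub_distrib, Finset.mul_sum]
        refine Finset.sum_congr rfl fun k _ => ?_
        rw [← mul_sub, ← Finset.sum_sub_distrib, mul_left_comm, Finset.mul_sum]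
        congr 1
        exact Finset.sum_congr rfl fun ω _ => by ring
    _ ≤ _ := by
        refine Finset.sum_le_sum fun k _ => mul_le_mul_of_nonneg_left ?_ (hb0 k)
        refine Finset.sum_le_sum fun ω _ => ?_
        rw [mul_assoc]
        exact mul_le_mul_of_nonneg_left (ptwise k ω) (hq0 ω)

section StochasticBlockModel

variable {N K : ℕ} {S : Type*}

/-- Interaction laws where the law between the node `i` and a node of block `l` is replaced by
`fstar l`, irrespective of the block of `i`. -/
def perturbedLaw (f : Fin K → Fin K → S → ℝ) (fstar : Fin K → S → ℝ) (i : Fin N)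
    (σ : Fin N → Fin K) (p : PairIdx N) : S → ℝ :=
  if p.1.1 = i then fstar (σ p.1.2)
  else if p.1.2 = i then fstar (σ p.1.1) else f (σ p.1.1) (σ p.1.2)

theorem perturbedLaw_pos {f : Fin K → Fin K → S → ℝ} (hfpos : ∀ k l x, 0 < f k l x)
    {fstar : Fin K → S → ℝ} (hfspos : ∀ k x, 0 < fstar k x) (i : Fin N) (σ : Fin N → Fin K)
    (p : PairIdx N) (x : S) : 0 < perturbedLaw f fstar i σ p x := by
  unfold perturbedLaw
  split_ifs
  exacts [hfspos _ _, hfspos _ _, hfpos _ _ _]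

/-- Only the pairs containing `i` contribute to a divergence between the perturbed laws and the
original ones in which `i` has label `k`. -/
theorem sum_divergence_perturbedLaw {f : Fin K → Fin K → S → ℝ} (hfsym : ∀ k l, f k l = f l k)
    (fstar : Fin K → S → ℝ) {D : (S → ℝ) → (S → ℝ) → ℝ} (hD : ∀ k l, D (f k l) (f k l) = 0)
    (i : Fin N) (σ : Fin N → Fin K) (k : Fin K) :
    ∑ p : PairIdx N, D (perturbedLaw f fstar i σ p)
        (f (Function.update σ i k p.1.1) (Function.update σ i k p.1.2))
      = ∑ j, if j = i then 0 else D (fstar (σ j)) (f k (σ j)) := by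
  rw [← sum_pairIdx_incident i fun j => D (fstar (σ j)) (f k (σ j))]
  refine Finset.sum_congr rfl fun p _ => ?_
  have hp : p.1.1 ≠ p.1.2 := p.2.ne
  unfold perturbedLaw
  by_cases h1 : p.1.1 = i
  · have h2 : p.1.2 ≠ i := fun h => hp (h1.trans h.symm)
    rw [if_pos h1, if_pos h1, Function.update_of_ne h2, h1, Function.update_self]
  · by_cases h2 : p.1.2 = i
    · rw [if_neg h1, if_neg h1, if_pos h2, if_pos h2, Function.update_of_ne h1, h2,
        Function.update_self, hfsym]
    · rw [if_neg h1, if_neg h1, if_neg h2, if_neg h2, Function.update_of_ne h1,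
        Function.update_of_ne h2, hD]

theorem sum_ite_eq_zero_const (i : Fin N) (c : ℝ) :
    ∑ j : Fin N, (if j = i then 0 else c) = ((N : ℝ) - 1) * c := by
  have h : ∀ j, (if j = i then 0 else c) = c - if j = i then c else 0 := by
    intro j; split_ifs <;> simp
  simp_rw [h, Finset.sum_sub_distrib]
  simp [sub_mul]

variable [Fintype S]

theorem sum_perturbedLaw {f : Fin K → Fin K → S → ℝ} (hf1 : ∀ k l, ∑ x, f k l x = 1)
    {fstar : Fin K → S → ℝ} (hfs1 : ∀ k, ∑ x, fstar k x = 1) (i : Fin N) (σ : Fin N → Fin K)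
    (p : PairIdx N) : ∑ x, perturbedLaw f fstar i σ p x = 1 := by
  unfold perturbedLaw
  split_ifs
  exacts [hfs1 _, hfs1 _, hf1 _ _]

/-- Second moment of the log-likelihood ratio under the perturbed law, for a fixed label `k` of
the node `i`. -/
theorem sum_sq_logRatio_perturbedLaw {f : Fin K → Fin K → S → ℝ}
    (hfpos : ∀ k l x, 0 < f k l x) (hfsym : ∀ k l, f k l = f l k)
    (hf1 : ∀ k l, ∑ x, f k l x = 1) {α : Fin K → ℝ} (hα1 : ∑ k, α k = 1)
    {fstar : Fin K → S → ℝ} (hfs1 : ∀ k, ∑ x, fstar k x = 1) (i : Fin N) (k : Fin K) (c : ℝ) :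
    ∑ ω : (Fin N → Fin K) × (PairIdx N → S),
        ((∏ j, α (ω.1 j)) * ∏ p, perturbedLaw f fstar i ω.1 p (ω.2 p)) *
        (∑ p : PairIdx N, Real.log (perturbedLaw f fstar i ω.1 p (ω.2 p) /
          f (Function.update ω.1 i k p.1.1) (Function.update ω.1 i k p.1.2) (ω.2 p)) - c) ^ 2
      = ((N : ℝ) - 1) * (∑ l, α l * vKL (fstar l) (f k l))
        + ((N : ℝ) - 1) * (∑ l, α l * dKL (fstar l) (f k l) ^ 2
            - (∑ l, α l * dKL (fstar l) (f k l)) ^ 2)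
        + (((N : ℝ) - 1) * (∑ l, α l * dKL (fstar l) (f k l)) - c) ^ 2 := by
  have given_labels : ∀ σ : Fin N → Fin K, ∑ x : PairIdx N → S,
      (∏ p, perturbedLaw f fstar i σ p (x p)) *
        (∑ p : PairIdx N, Real.log (perturbedLaw f fstar i σ p (x p) /
          f (Function.update σ i k p.1.1) (Function.update σ i k p.1.2) (x p)) - c) ^ 2
      = (∑ j, if j = i then 0 else vKL (fstar (σ j)) (f k (σ j)))
        + ((∑ j, if j = i then 0 else dKL (fstar (σ j)) (f k (σ j))) - c) ^ 2 := by
    intro σ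
    rw [← sum_divergence_perturbedLaw hfsym fstar (fun k l => vKL_self (hfpos k l)),
      ← sum_divergence_perturbedLaw hfsym fstar (fun k l => dKL_self (hfpos k l))]
    exact sum_pi_prod_mul_sum_sub_sq (fun p => sum_perturbedLaw hf1 hfs1 i σ p)
      (fun p s => Real.log (perturbedLaw f fstar i σ p s /
        f (Function.update σ i k p.1.1) (Function.update σ i k p.1.2) s)) c
  rw [Fintype.sum_prod_type]
  simp_rw [mul_assoc, ← Finset.mul_sum, given_labels, mul_add, Finset.sum_add_distrib]
  have hw : ∀ _j : Fin N, ∑ l, α l = 1 := fun _ => hα1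
  have hv := sum_pi_prod_mul_sum (w := fun _ => α) hw
    (fun j l => if j = i then 0 else vKL (fstar l) (f k l))
  have hd := sum_pi_prod_mul_sum_sub_sq (w := fun _ => α) hw
    (fun j l => if j = i then 0 else dKL (fstar l) (f k l)) c
  rw [hv, hd]
  have pull : ∀ u : Fin K → ℝ, ∀ j : Fin N, ∑ l, α l * (if j = i then 0 else u l)
      = if j = i then 0 else ∑ l, α l * u l := by
    intro u j; split_ifs <;> simp
  have var_pull : ∀ j : Fin N, (∑ l, α l * (if j = i then 0 else dKL (fstar l) (f k l)) ^ 2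
      - (∑ l, α l * (if j = i then 0 else dKL (fstar l) (f k l))) ^ 2)
      = if j = i then 0 else ∑ l, α l * dKL (fstar l) (f k l) ^ 2
            - (∑ l, α l * dKL (fstar l) (f k l)) ^ 2 := by
    intro j; split_ifs <;> simp
  simp_rw [var_pull, pull, sum_ite_eq_zero_const]
  rw [add_assoc]

/-- The joint weight of labels `σ` and interactions `x`. -/
def sbmWeight (f : Fin K → Fin K → S → ℝ) (α : Fin K → ℝ) (σ : Fin N → Fin K)
    (x : PairIdx N → S) : ℝ :=
  (∏ i, α (σ i)) * ∏ p : PairIdx N, f (σ p.1.1) (σ p.1.2) (x p)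

/-- Lower bound on the probability of misclassifying the node `i` when the label of `i` is guessed
from the interactions and the labels of the other nodes. -/
theorem exp_mul_le_node_error {f : Fin K → Fin K → S → ℝ}
    (hfpos : ∀ k l x, 0 < f k l x) (hfsym : ∀ k l, f k l = f l k)
    (hf1 : ∀ k l, ∑ x, f k l x = 1)
    {α : Fin K → ℝ} (hαpos : ∀ k, 0 < α k) (hα1 : ∑ k, α k = 1)
    {fstar : Fin K → S → ℝ} (hfspos : ∀ k x, 0 < fstar k x) (hfs1 : ∀ k, ∑ x, fstar k x = 1)
    {αstar : Fin K → ℝ} {a ε m V : ℝ} (ha : 0 < a) (hε : 0 < ε)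
    (hs0 : ∀ k, 0 ≤ αstar k) (hs1 : ∑ k, αstar k = 1) (hs : ∀ k, a * αstar k ≤ α k)
    (hsmax : ∀ k, αstar k ≤ 1 - 4 * ε) (i : Fin N)
    (hV : ∑ k, αstar k * (((N : ℝ) - 1) * (∑ l, α l * vKL (fstar l) (f k l))
        + ((N : ℝ) - 1) * (∑ l, α l * dKL (fstar l) (f k l) ^ 2
            - (∑ l, α l * dKL (fstar l) (f k l)) ^ 2)
        + (((N : ℝ) - 1) * (∑ l, α l * dKL (fstar l) (f k l)) - m) ^ 2) ≤ V)
    (ψ : (Fin N → Fin K) → (PairIdx N → S) → Fin K)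
    (hψ : ∀ σ x k, ψ (Function.update σ i k) x = ψ σ x) :
    a * (3 * ε * Real.exp (-m - (√ε)⁻¹ * √V))
      ≤ ∑ σ : Fin N → Fin K, ∑ x : PairIdx N → S,
          sbmWeight f α σ x * (if σ i ≠ ψ σ x then 1 else 0) := by
  set q : (Fin N → Fin K) × (PairIdx N → S) → ℝ :=
    fun ω => (∏ j, α (ω.1 j)) * ∏ p, perturbedLaw f fstar i ω.1 p (ω.2 p) with hq
  set L : Fin K → (Fin N → Fin K) × (PairIdx N → S) → ℝ := fun k ω =>
    ∑ p : PairIdx N, Real.log (perturbedLaw f fstar i ω.1 p (ω.2 p) /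
      f (Function.update ω.1 i k p.1.1) (Function.update ω.1 i k p.1.2) (ω.2 p)) with hL
  have hq0 : ∀ ω, 0 ≤ q ω := fun ω => mul_nonneg (Finset.prod_nonneg fun j _ => (hαpos _).le)
    (Finset.prod_nonneg fun p _ => (perturbedLaw_pos hfpos hfspos i ω.1 p _).le)
  have hq1 : ∑ ω, q ω = 1 := by
    rw [Fintype.sum_prod_type]
    simp only [hq, ← Finset.mul_sum]
    simp_rw [fun σ => sum_pi_prod_eq_one (w := perturbedLaw f fstar i σ)
      (fun p => sum_perturbedLaw hf1 hfs1 i σ p), mul_one]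
    exact sum_pi_prod_eq_one (w := fun _ => α) fun _ => hα1
  have hmain := exp_mul_le_sum_guess_error hq0 hq1 hs0 hs1 L (fun ω => ψ ω.1 ω.2) (m := m)
    (V := V) hε hsmax
    (by simpa only [hq, hL, sum_sq_logRatio_perturbedLaw hfpos hfsym hf1 hα1 hfs1] using hV)
  have hrepr : ∑ σ : Fin N → Fin K, ∑ x : PairIdx N → S,
        sbmWeight f α σ x * (if σ i ≠ ψ σ x then 1 else 0)
      = ∑ k, α k * ∑ ω, q ω * Real.exp (-L k ω) * (if k ≠ ψ ω.1 ω.2 then 1 else 0) := by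
    simp only [sbmWeight, mul_assoc, ← Finset.mul_sum]
    rw [sum_pi_prod_mul_eq_sum_update hα1 i]
    refine Finset.sum_congr rfl fun k _ => ?_
    rw [Fintype.sum_prod_type]
    congr 1
    refine Finset.sum_congr rfl fun σ _ => ?_
    rw [Finset.mul_sum]
    refine Finset.sum_congr rfl fun x _ => ?_
    rw [prod_eq_prod_mul_exp_neg_sum_log (a := fun p => perturbedLaw f fstar i σ p (x p))
      (fun p => perturbedLaw_pos hfpos hfspos i σ p _) (fun p => hfpos _ _ _),
      Function.update_self, hψ]
    simp only [hq, hL, mul_assoc]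
  rw [hrepr]
  refine (mul_le_mul_of_nonneg_left hmain ha.le).trans ?_
  rw [Finset.mul_sum]
  refine Finset.sum_le_sum fun k _ => ?_
  rw [← mul_assoc]
  refine mul_le_mul_of_nonneg_right (hs k) (Finset.sum_nonneg fun ω _ => ?_)
  have := hq0 ω
  positivity

/-- The absolute classification error dominates a multiple of the number of misaligned nodes,
except when some block is small. -/
theorem le_hamStar_of_blocks {a : ℝ} (ha0 : 0 ≤ a) (ha1 : a ≤ 1) (haN : 8 ≤ N * a)
    (σ τ : Fin N → Fin K) :
    a / 8 * (∑ i, (if σ i ≠ alignExcept i σ τ (τ i) then (1 : ℝ) else 0)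
      - N * (if ∃ k, ((Finset.univ.filter fun j => σ j = k).card : ℝ) < N * a / 2
          then 1 else 0)) ≤ hamStar σ τ := by
  have hcard : ∑ i, (if σ i ≠ alignExcept i σ τ (τ i) then (1 : ℝ) else 0)
      = ((Finset.univ.filter fun i => σ i ≠ alignExcept i σ τ (τ i)).card : ℝ) := by
    rw [Finset.sum_boole]
  have hle : ((Finset.univ.filter fun i => σ i ≠ alignExcept i σ τ (τ i)).card : ℝ) ≤ N := by
    have := Finset.card_filter_le (Finset.univ : Finset (Fin N))
      fun i => σ i ≠ alignExcept i σ τ (τ i)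
    rw [Finset.card_univ, Fintype.card_fin] at this
    exact_mod_cast this
  have hh : (0 : ℝ) ≤ hamStar σ τ := Nat.cast_nonneg _
  rw [hcard]
  split_ifs with hbad
  · refine le_trans (mul_nonpos_of_nonneg_of_nonpos (by positivity) ?_) hh
    linarith
  · push Not at hbad
    rw [mul_zero, sub_zero]
    rcases le_hamStar_or_hamStar_eq σ τ ⌈(N : ℝ) * a / 2⌉₊ (fun k => Nat.ceil_le.2 (hbad k))
      with h | h
    · have h1 : (N : ℝ) * a / 2 ≤ 2 * hamStar σ τ + 1 := by
        refine (Nat.le_ceil _).trans ?_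
        exact_mod_cast h
      have h2 := mul_le_mul_of_nonneg_left hle (show 0 ≤ a / 8 by positivity)
      linarith
    · rw [h]
      refine mul_le_of_le_one_left (Nat.cast_nonneg _) (by linarith)

/-- A lower bound on the probability of misaligning each single node yields a lower bound on the
expected absolute classification error. -/
theorem le_sum_sbmWeight_mul_hamStar {f : Fin K → Fin K → S → ℝ}
    (hfpos : ∀ k l x, 0 < f k l x) (hf1 : ∀ k l, ∑ x, f k l x = 1)
    {α : Fin K → ℝ} (hαpos : ∀ k, 0 < α k) (hα1 : ∑ k, α k = 1) {a e : ℝ} (ha0 : 0 ≤ a)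
    (ha1 : a ≤ 1) (ha : ∀ k, a ≤ α k) (haN : 8 ≤ N * a)
    (σhat : (PairIdx N → S) → (Fin N → Fin K))
    (he : ∀ i, e ≤ ∑ σ : Fin N → Fin K, ∑ x : PairIdx N → S, sbmWeight f α σ x *
      (if σ i ≠ alignExcept i σ (σhat x) (σhat x i) then 1 else 0)) :
    a / 8 * (N * e - N * (K * Real.exp (-(N : ℝ) * a / 8)))
      ≤ ∑ σ : Fin N → Fin K, ∑ x : PairIdx N → S,
          sbmWeight f α σ x * (hamStar σ (σhat x) : ℝ) := by
  have hw0 : ∀ (σ : Fin N → Fin K) (x : PairIdx N → S), 0 ≤ sbmWeight f α σ x := fun σ x =>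
    mul_nonneg (Finset.prod_nonneg fun j _ => (hαpos _).le)
      (Finset.prod_nonneg fun p _ => (hfpos _ _ _).le)
  set bad : (Fin N → Fin K) → ℝ := fun σ =>
    if ∃ k, ((Finset.univ.filter fun j => σ j = k).card : ℝ) < N * a / 2 then 1 else 0 with hbad
  have hP : ∑ σ : Fin N → Fin K, ∑ x : PairIdx N → S, sbmWeight f α σ x * bad σ
      ≤ K * Real.exp (-(N : ℝ) * a / 8) := by
    refine le_trans (le_of_eq ?_) (sum_prod_small_block_le (fun k => (hαpos k).le) hα1 ha)
    refine Finset.sum_congr rfl fun σ _ => ?_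
    simp only [sbmWeight, ← Finset.sum_mul, ← Finset.mul_sum]
    rw [sum_pi_prod_eq_one (w := fun p : PairIdx N => f (σ p.1.1) (σ p.1.2))
      (fun p => hf1 _ _), mul_one]
  have hE : (N : ℝ) * e ≤ ∑ σ : Fin N → Fin K, ∑ x : PairIdx N → S, sbmWeight f α σ x *
      ∑ i, (if σ i ≠ alignExcept i σ (σhat x) (σhat x i) then (1 : ℝ) else 0) := by
    calc (N : ℝ) * e = ∑ _i : Fin N, e := by simp
      _ ≤ _ := Finset.sum_le_sum fun i _ => he i
      _ = _ := by
        rw [Finset.sum_comm]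
        refine Finset.sum_congr rfl fun σ _ => ?_
        rw [Finset.sum_comm]
        simp_rw [Finset.mul_sum]
  calc _ ≤ a / 8 * ((∑ σ : Fin N → Fin K, ∑ x : PairIdx N → S, sbmWeight f α σ x *
          ∑ i, (if σ i ≠ alignExcept i σ (σhat x) (σhat x i) then (1 : ℝ) else 0))
        - N * ∑ σ : Fin N → Fin K, ∑ x : PairIdx N → S, sbmWeight f α σ x * bad σ) := by
        refine mul_le_mul_of_nonneg_left ?_ (by positivity)
        have := mul_le_mul_of_nonneg_left hP (Nat.cast_nonneg (α := ℝ) N)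
        linarith
    _ = ∑ σ : Fin N → Fin K, ∑ x : PairIdx N → S, sbmWeight f α σ x * (a / 8 *
          (∑ i, (if σ i ≠ alignExcept i σ (σhat x) (σhat x i) then (1 : ℝ) else 0)
            - N * bad σ)) := by
        rw [Finset.mul_sum, ← Finset.sum_sub_distrib, Finset.mul_sum]
        refine Finset.sum_congr rfl fun σ _ => ?_
        rw [Finset.mul_sum, ← Finset.sum_sub_distrib, Finset.mul_sum]
        exact Finset.sum_congr rfl fun x _ => by ring
    _ ≤ _ := Finset.sum_le_sum fun σ _ => Finset.sum_le_sum fun x _ =>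
        mul_le_mul_of_nonneg_left (le_hamStar_of_blocks ha0 ha1 haN σ (σhat x)) (hw0 σ x)

end StochasticBlockModel

/-- Quantitative lower bound on the expected classification error of any estimator in a
general (non-homogeneous) stochastic block model with i.i.d. `α`-distributed labels. -/
theorem lower_bound_general_sbm
    (N K : ℕ) [NeZero K] (S : Type*) [Fintype S]
    (f : Fin K → Fin K → S → ℝ)
    (hfpos : ∀ k l x, 0 < f k l x) (hfsym : ∀ k l, f k l = f l k)
    (hf1 : ∀ k l, ∑ x, f k l x = 1)
    (α : Fin K → ℝ) (hαpos : ∀ k, 0 < α k) (hα1 : ∑ k, α k = 1)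
    (𝒦 : Finset (Fin K)) (h𝒦 : 𝒦.Nonempty)
    (fstar : Fin K → S → ℝ)
    (hfspos : ∀ k x, 0 < fstar k x) (hfs1 : ∀ k, ∑ x, fstar k x = 1)
    (αmin α𝒦 δ : ℝ)
    (hαmin : αmin = Finset.univ.inf' Finset.univ_nonempty α)
    (hα𝒦 : α𝒦 = ∑ k ∈ 𝒦, α k)
    (hδ : δ = (1 / 4) * (α𝒦 - 𝒦.sup' h𝒦 α))
    (hδpos : 0 < δ)
    (hN : (N : ℝ) ≥ 8 * αmin⁻¹ * Real.log (K / δ))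
    (αstar : Fin K → ℝ)
    (hαstar : ∀ k, αstar k = if k ∈ 𝒦 then α k / α𝒦 else 0)
    (A B : Fin K → ℝ)
    (hA : ∀ k, A k = ∑ l, α l * dKL (fstar l) (f k l))
    (hB : ∀ k, B k =
      (∑ l, α l * (dKL (fstar l) (f k l)) ^ 2) - (∑ l, α l * dKL (fstar l) (f k l)) ^ 2)
    (I1 I21 I22 : ℝ)
    (hI1 : I1 = ∑ k, ∑ l, αstar k * α l * dKL (fstar l) (f k l))
    (hI21 : I21 = (∑ k, ∑ l, αstar k * α l * vKL (fstar l) (f k l)) + ∑ k, αstar k * B k)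
    (hI22 : I22 = (∑ k, αstar k * (A k) ^ 2) - (∑ k, αstar k * A k) ^ 2)
    (σhat : (PairIdx N → S) → (Fin N → Fin K)) :
    (∑ σ : Fin N → Fin K, ∑ x : PairIdx N → S,
        (∏ i, α (σ i)) * (∏ p : PairIdx N, f (σ p.1.1) (σ p.1.2) (x p)) *
          (hamStar σ (σhat x) : ℝ))
      ≥ (1 / 21) * N * αmin ^ 2 * δ *
          Real.exp (-(N : ℝ) * I1 - Real.sqrt α𝒦 * (Real.sqrt δ)⁻¹ *
            Real.sqrt ((N : ℝ) * I21 + (N : ℝ) ^ 2 * I22))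
        - (1 / 6) * N * αmin * K * Real.exp (-(N : ℝ) * αmin / 8) := by
  have hN0 : (0 : ℝ) ≤ N := Nat.cast_nonneg N
  have hmin_le : ∀ k, αmin ≤ α k := fun k => by
    rw [hαmin]; exact Finset.inf'_le _ (Finset.mem_univ k)
  have hmin_pos : 0 < αmin := by
    rw [hαmin, Finset.lt_inf'_iff]; exact fun k _ => hαpos k
  have hα_le : ∀ k, α k ≤ 1 := fun k =>
    hα1 ▸ Finset.single_le_sum (fun l _ => (hαpos l).le) (Finset.mem_univ k)
  have hmin_le_one : αmin ≤ 1 := (hmin_le 0).trans (hα_le 0)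
  have hα𝒦_pos : 0 < α𝒦 := hα𝒦 ▸ Finset.sum_pos (fun k _ => hαpos k) h𝒦
  have hα𝒦_le : α𝒦 ≤ 1 := by
    rw [hα𝒦, ← hα1]
    exact Finset.sum_le_sum_of_subset_of_nonneg (Finset.subset_univ _) fun k _ _ => (hαpos k).le
  have hsup : ∀ k ∈ 𝒦, α k ≤ α𝒦 - 4 * δ := fun k hk => by
    have := Finset.le_sup' α hk
    linarith
  have h𝒦_le : 4 * δ ≤ α𝒦 := by
    obtain ⟨k, hk⟩ := h𝒦
    linarith [hsup k hk, hαpos k]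
  have hNα : 8 ≤ (N : ℝ) * αmin := by
    have hK : (1 : ℝ) ≤ K := by exact_mod_cast NeZero.one_le
    have hlog : 1 ≤ Real.log (K / δ) := by
      rw [Real.le_log_iff_exp_le (by positivity), le_div_iff₀ hδpos]
      have he := Real.exp_one_lt_d9
      nlinarith
    calc (8 : ℝ) = 8 * αmin⁻¹ * 1 * αmin := by field_simp
      _ ≤ 8 * αmin⁻¹ * Real.log (K / δ) * αmin := by gcongr
      _ ≤ N * αmin := by gcongr
  have hs0 : ∀ k, 0 ≤ αstar k := fun k => by
    rw [hαstar]
    split_ifs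
    exacts [(div_pos (hαpos k) hα𝒦_pos).le, le_rfl]
  have hs1 : ∑ k, αstar k = 1 := by
    simp_rw [hαstar]
    rw [Finset.sum_ite_mem, Finset.univ_inter, ← Finset.sum_div, ← hα𝒦, div_self hα𝒦_pos.ne']
  have hs : ∀ k, α𝒦 * αstar k ≤ α k := fun k => by
    rw [hαstar]
    split_ifs
    · rw [mul_div_cancel₀ _ hα𝒦_pos.ne']
    · simpa using (hαpos k).le
  have hsmax : ∀ k, αstar k ≤ 1 - 4 * (δ / α𝒦) := fun k => by
    have h1 : 1 - 4 * (δ / α𝒦) = (α𝒦 - 4 * δ) / α𝒦 := by field_simp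
    rw [hαstar, h1]
    split_ifs with hk
    · exact div_le_div_of_nonneg_right (hsup k hk) hα𝒦_pos.le
    · exact div_nonneg (by linarith) hα𝒦_pos.le
  have hI1A : I1 = ∑ k, αstar k * A k := by
    rw [hI1]
    refine Finset.sum_congr rfl fun k _ => ?_
    rw [hA, Finset.mul_sum]
    exact Finset.sum_congr rfl fun l _ => by ring
  have hI1_nonneg : 0 ≤ I1 := by
    rw [hI1]
    exact Finset.sum_nonneg fun k _ => Finset.sum_nonneg fun l _ =>
      mul_nonneg (mul_nonneg (hs0 k) (hαpos l).le)
        (dKL_nonneg (hfspos l) (hfpos k l) (hfs1 l) (hf1 k l))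
  have hI21_nonneg : 0 ≤ I21 := by
    rw [hI21]
    refine add_nonneg (Finset.sum_nonneg fun k _ => Finset.sum_nonneg fun l _ =>
      mul_nonneg (mul_nonneg (hs0 k) (hαpos l).le) (vKL_nonneg (hfspos l) (hfs1 l)))
      (Finset.sum_nonneg fun k _ => mul_nonneg (hs0 k) ?_)
    rw [hB]
    exact sum_mul_sq_sub_sq_nonneg (fun l => (hαpos l).le) hα1 _
  have hI22_nonneg : 0 ≤ I22 := by
    rw [hI22]
    exact sum_mul_sq_sub_sq_nonneg hs0 hs1 _
  have hN1 : (1 : ℝ) ≤ N := by nlinarith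
  set V : ℝ := (N : ℝ) * I21 + (N : ℝ) ^ 2 * I22 with hVdef
  have hV : ∑ k, αstar k * (((N : ℝ) - 1) * (∑ l, α l * vKL (fstar l) (f k l))
        + ((N : ℝ) - 1) * (∑ l, α l * dKL (fstar l) (f k l) ^ 2
            - (∑ l, α l * dKL (fstar l) (f k l)) ^ 2)
        + (((N : ℝ) - 1) * (∑ l, α l * dKL (fstar l) (f k l)) - ((N : ℝ) - 1) * I1) ^ 2)
      ≤ V := by
    have h21 : I21 = ∑ k, αstar k * (∑ l, α l * vKL (fstar l) (f k l))
        + ∑ k, αstar k * B k := by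
      rw [hI21]
      congr 1
      refine Finset.sum_congr rfl fun k _ => ?_
      rw [Finset.mul_sum]
      exact Finset.sum_congr rfl fun l _ => by ring
    have hterm : ∀ k, αstar k * (((N : ℝ) - 1) * (∑ l, α l * vKL (fstar l) (f k l))
        + ((N : ℝ) - 1) * (∑ l, α l * dKL (fstar l) (f k l) ^ 2
            - (∑ l, α l * dKL (fstar l) (f k l)) ^ 2)
        + (((N : ℝ) - 1) * (∑ l, α l * dKL (fstar l) (f k l)) - ((N : ℝ) - 1) * I1) ^ 2)
        = ((N : ℝ) - 1) * (αstar k * (∑ l, α l * vKL (fstar l) (f k l)))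
          + ((N : ℝ) - 1) * (αstar k * B k)
          + (((N : ℝ) - 1) ^ 2 * (αstar k * A k ^ 2)
            - ((N : ℝ) - 1) ^ 2 * (2 * I1) * (αstar k * A k)
            + ((N : ℝ) - 1) ^ 2 * I1 ^ 2 * αstar k) := by
      intro k
      rw [hB, hA]
      ring
    simp_rw [hterm, Finset.sum_add_distrib, Finset.sum_sub_distrib, ← Finset.mul_sum]
    rw [hs1, ← hI1A]
    have h22 : ∑ k, αstar k * A k ^ 2 = I22 + I1 ^ 2 := by rw [hI22, hI1A]; ring
    rw [h22, hVdef]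
    have h3 : ((N : ℝ) - 1) ^ 2 * I22 ≤ (N : ℝ) ^ 2 * I22 :=
      mul_le_mul_of_nonneg_right (pow_le_pow_left₀ (by linarith) (by linarith) 2) hI22_nonneg
    have h4 : ((N : ℝ) - 1) * I21 ≤ N * I21 := by nlinarith
    rw [h21] at h4 ⊢
    linarith
  have hnode : ∀ i, 3 * δ * Real.exp (-(N : ℝ) * I1 - √α𝒦 * (√δ)⁻¹ * √V)
      ≤ ∑ σ : Fin N → Fin K, ∑ x : PairIdx N → S, sbmWeight f α σ x *
        (if σ i ≠ alignExcept i σ (σhat x) (σhat x i) then 1 else 0) := by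
    intro i
    refine le_trans ?_ (exp_mul_le_node_error hfpos hfsym hf1 hαpos hα1 hfspos hfs1 hα𝒦_pos
      (div_pos hδpos hα𝒦_pos) hs0 hs1 hs hsmax i hV
      (fun σ x => alignExcept i σ (σhat x) (σhat x i))
      (fun σ x k => by rw [alignExcept_update]))
    have hsqrt : (√(δ / α𝒦))⁻¹ = √α𝒦 * (√δ)⁻¹ := by
      rw [Real.sqrt_div hδpos.le, inv_div, div_eq_mul_inv]
    have hfac : α𝒦 * (3 * (δ / α𝒦) * Real.exp (-(((N : ℝ) - 1) * I1) - √α𝒦 * (√δ)⁻¹ * √V))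
        = 3 * δ * Real.exp (-(((N : ℝ) - 1) * I1) - √α𝒦 * (√δ)⁻¹ * √V) := by
      field_simp
    rw [hsqrt, hfac]
    refine mul_le_mul_of_nonneg_left (Real.exp_le_exp.2 ?_) (by positivity)
    linarith
  have hmain := le_sum_sbmWeight_mul_hamStar hfpos hf1 hαpos hα1 hmin_pos.le hmin_le_one hmin_le
    hNα σhat hnode
  refine ge_iff_le.2 (le_trans ?_ hmain)
  set e := Real.exp (-(N : ℝ) * I1 - √α𝒦 * (√δ)⁻¹ * √V)
  have he : 0 ≤ N * αmin * δ * e := by positivity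
  have h1 : (N : ℝ) * αmin ^ 2 * δ * e ≤ N * αmin * δ * e := by
    calc (N : ℝ) * αmin ^ 2 * δ * e = αmin * (N * αmin * δ * e) := by ring
      _ ≤ _ := mul_le_of_le_one_left he hmin_le_one
  have h2 : 0 ≤ (N : ℝ) * αmin * K * Real.exp (-(N : ℝ) * αmin / 8) := by positivity
  linarith
end
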